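/- Let f ∈ ℬ and fix x, y ∈ [0,∞)^d, and set M = max{x_1, y_1, x_2, y_2, …, x_d, y_d}. Then with probability one, limsup_{n→∞} n^{-1/d} (U_n(x) − U_n(y)) ≤ c_d · d · M^{(d−1)/d} · (sup_{[0,M]^d} f)^{1/d} · |x − y|^{1/d}. -/

import Mathlib

open MeasureTheory Filter Set Topology

noncomputable section

/-- `ℓ(A)`: the maximal cardinality of a chain (finite subset totally ordered by the
coordinatewise partial order `≤`) contained in `A ⊆ ℝ^d`. -/
def chainLength (d : ℕ) (A : Set (Fin d → ℝ)) : ℕ :=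
  sSup {n : ℕ | ∃ C : Finset (Fin d → ℝ),
    ↑C ⊆ A ∧ IsChain (· ≤ ·) (C : Set (Fin d → ℝ)) ∧ C.card = n}

/-- The class `ℬ` of nonnegative, locally bounded, Lebesgue-measurable functions. -/
def MemB (d : ℕ) (f : (Fin d → ℝ) → ℝ) : Prop :=
  Measurable f ∧ (∀ x, 0 ≤ f x) ∧ ∀ x : Fin d → ℝ, ∃ U ∈ 𝓝 x, BddAbove (f '' U)

/-- The Euclidean norm on `ℝ^d` (modelled as `Fin d → ℝ`). -/
def euclNorm (d : ℕ) (x : Fin d → ℝ) : ℝ := Real.sqrt (∑ i, (x i) ^ 2)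

/-- The expectation `E[ℓ_n]` of the length of a longest chain among `n` i.i.d. points
uniformly distributed in the unit cube `[0,1]^d`. -/
def BWexpect (d n : ℕ) : ℝ :=
  ∫ X : Fin n → Fin d → ℝ, (chainLength d (Set.range X) : ℝ)
    ∂(Measure.pi fun _ => volume.restrict (Set.Icc (0 : Fin d → ℝ) 1))

/-- `c` is the Bollobás–Winkler constant `c_d`: `c > 0` and `n^{-1/d} E[ℓ_n] → c`. -/
def IsBWConstant (d : ℕ) (c : ℝ) : Prop :=
  0 < c ∧ Tendsto (fun n : ℕ => (n : ℝ) ^ (-(1 : ℝ) / d) * BWexpect d n) atTop (nhds c)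

/-- A Poisson point process on `ℝ^d` with intensity function `g`, on a probability space
`(Ω, P)`: a random at-most-countable subset of `ℝ^d` such that for every bounded Borel set `A`
the count `#(pts ω ∩ A)` is measurable with Poisson distribution of mean `∫_A g`, and counts of
pairwise disjoint Borel sets are independent. -/
structure PoissonPP (d : ℕ) {Ω : Type*} [MeasurableSpace Ω] (P : Measure Ω)
    (g : (Fin d → ℝ) → ℝ) where
  pts : Ω → Set (Fin d → ℝ)
  countable : ∀ ω, (pts ω).Countable
  measur : ∀ A : Set (Fin d → ℝ), MeasurableSet A → Bornology.IsBounded A →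
    ∀ k : ℕ, MeasurableSet {ω | (pts ω ∩ A).encard = k}
  poisson : ∀ A : Set (Fin d → ℝ), MeasurableSet A → Bornology.IsBounded A →
    ∀ k : ℕ, P {ω | (pts ω ∩ A).encard = k}
      = ENNReal.ofReal (Real.exp (-(∫ x in A, g x)) * (∫ x in A, g x) ^ k / k.factorial)
  indep : ∀ (n : ℕ) (A : Fin n → Set (Fin d → ℝ)),
    (∀ i, MeasurableSet (A i)) → (∀ i, Bornology.IsBounded (A i)) →
    (Pairwise fun i j => Disjoint (A i) (A j)) →
    ∀ k : Fin n → ℕ,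
      P (⋂ i, {ω | (pts ω ∩ A i).encard = k i})
        = ∏ i, P {ω | (pts ω ∩ A i).encard = k i}

/-- Upper semicontinuous envelope `f*`. -/
def upperEnv (d : ℕ) (f : (Fin d → ℝ) → ℝ) (x : Fin d → ℝ) : ℝ := limsup f (𝓝 x)

/-- Lower semicontinuous envelope `f_*`. -/
def lowerEnv (d : ℕ) (f : (Fin d → ℝ) → ℝ) (x : Fin d → ℝ) : ℝ := liminf f (𝓝 x)

/-- The simplex `S_{x,v} = {z : z ≤ x, ⟨x-z,v⟩ ≤ 1}`. -/
def simplexS (d : ℕ) (x v : Fin d → ℝ) : Set (Fin d → ℝ) :=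
  {z | z ≤ x ∧ ∑ i, (x i - z i) * v i ≤ 1}

/-- `u` is a nondecreasing viscosity solution of the problem (P):
`u_{x_1} ⋯ u_{x_d} = (c_d/d)^d f` in `(0,∞)^d`, `u = 0` on `∂ℝ^d_+`. -/
def IsNDViscSol (d : ℕ) (c : ℝ) (f u : (Fin d → ℝ) → ℝ) : Prop :=
  ContinuousOn u (Set.Ici 0) ∧
  (∀ x y : Fin d → ℝ, 0 ≤ x → x ≤ y → u x ≤ u y) ∧
  (∀ x : Fin d → ℝ, 0 ≤ x → (∃ i, x i = 0) → u x = 0) ∧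
  (∀ x₀ : Fin d → ℝ, (∀ i, 0 < x₀ i) →
    ∀ φ : (Fin d → ℝ) → ℝ, ContDiff ℝ ((⊤ : ℕ∞) : WithTop ℕ∞) φ →
      IsLocalMaxOn (fun y => u y - φ y) (Set.Ici 0) x₀ →
      ∏ i, fderiv ℝ φ x₀ (Pi.single i 1) ≤ (c / d) ^ d * upperEnv d f x₀) ∧
  (∀ x₀ : Fin d → ℝ, (∀ i, 0 < x₀ i) →
    ∀ φ : (Fin d → ℝ) → ℝ, ContDiff ℝ ((⊤ : ℕ∞) : WithTop ℕ∞) φ →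
      IsLocalMinOn (fun y => u y - φ y) (Set.Ici 0) x₀ →
      (c / d) ^ d * lowerEnv d f x₀ ≤ ∏ i, fderiv ℝ φ x₀ (Pi.single i 1))

section FiniteChains

open scoped BigOperators

variable {α : Type*} [PartialOrder α]

open Classical in
/-- The maximal cardinality of a chain contained in a finite set. -/
def maxChainCard (T : Finset α) : ℕ :=
  (T.powerset.filter fun C : Finset α => IsChain (· ≤ ·) (C : Set α)).sup Finset.card

theorem card_le_maxChainCard {T C : Finset α} (hCT : C ⊆ T)
    (hC : IsChain (· ≤ ·) (C : Set α)) : C.card ≤ maxChainCard T := by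
  classical
  exact Finset.le_sup (f := Finset.card) (by simp [hCT, hC])

theorem exists_isChain_card_eq_maxChainCard (T : Finset α) :
    ∃ C ⊆ T, IsChain (· ≤ ·) (C : Set α) ∧ C.card = maxChainCard T := by
  classical
  obtain ⟨C, hC, h⟩ := Finset.exists_mem_eq_sup
    (T.powerset.filter fun C : Finset α => IsChain (· ≤ ·) (C : Set α)) ⟨∅, by simp⟩ Finset.card
  rw [Finset.mem_filter, Finset.mem_powerset] at hC
  exact ⟨C, hC.1, hC.2, h.symm⟩

theorem maxChainCard_mono {S T : Finset α} (h : S ⊆ T) : maxChainCard S ≤ maxChainCard T := by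
  obtain ⟨C, hC, hc, h'⟩ := exists_isChain_card_eq_maxChainCard S
  exact h' ▸ card_le_maxChainCard (hC.trans h) hc

theorem maxChainCard_le_card (T : Finset α) : maxChainCard T ≤ T.card := by
  obtain ⟨C, hC, -, h'⟩ := exists_isChain_card_eq_maxChainCard T
  exact h' ▸ Finset.card_le_card hC

theorem maxChainCard_insert_le [DecidableEq α] (a : α) (T : Finset α) :
    maxChainCard (insert a T) ≤ maxChainCard T + 1 := by
  obtain ⟨C, hC, hc, h'⟩ := exists_isChain_card_eq_maxChainCard (insert a T)
  have h1 : (C.erase a).card ≤ maxChainCard T :=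
    card_le_maxChainCard (by rwa [← Finset.subset_insert_iff])
      (hc.mono (by exact_mod_cast Finset.erase_subset a C))
  have h2 := Finset.pred_card_le_card_erase (s := C) (a := a)
  omega

variable [DecidableEq α] {k : ℕ}

/-- The maximal cardinality of a chain among the entries of a tuple. -/
def tupleChain (q : Fin k → α) : ℕ := maxChainCard (Finset.univ.image q)

/-- The maximal cardinality of a chain among the entries of a tuple, the `i`-th one excluded. -/
def tupleChainErase (i : Fin k) (q : Fin k → α) : ℕ :=
  maxChainCard ((Finset.univ.erase i).image q)

theorem tupleChain_le (q : Fin k → α) : tupleChain q ≤ k :=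
  (maxChainCard_le_card _).trans (Finset.card_image_le.trans (by simp))

theorem tupleChainErase_update (i : Fin k) (q : Fin k → α) (v : α) :
    tupleChainErase i (Function.update q i v) = tupleChainErase i q := by
  unfold tupleChainErase
  congr 1
  refine Finset.image_congr fun j hj => ?_
  have : j ≠ i := by simpa using hj
  simp [this]

theorem tupleChainErase_le (i : Fin k) (q : Fin k → α) : tupleChainErase i q ≤ tupleChain q :=
  maxChainCard_mono (Finset.image_subset_image (Finset.erase_subset _ _))

theorem tupleChain_le_tupleChainErase_add_one (i : Fin k) (q : Fin k → α) :
    tupleChain q ≤ tupleChainErase i q + 1 := by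
  unfold tupleChain tupleChainErase
  rw [← Finset.insert_erase (Finset.mem_univ i), Finset.image_insert,
    Finset.erase_insert (Finset.notMem_erase i _)]
  exact maxChainCard_insert_le _ _

theorem tupleChain_update_le (i : Fin k) (q : Fin k → α) (v : α) :
    tupleChain (Function.update q i v) ≤ tupleChain q + 1 := by
  have h1 := tupleChain_le_tupleChainErase_add_one i (Function.update q i v)
  rw [tupleChainErase_update] at h1
  have h2 := tupleChainErase_le i q
  omega

/-- At most `tupleChain q` entries of a tuple are needed for its longest chain. -/
theorem card_pivotal_le (q : Fin k → α) :
    (Finset.univ.filter fun i => tupleChainErase i q < tupleChain q).card ≤ tupleChain q := by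
  obtain ⟨C, hC, hc, h⟩ := exists_isChain_card_eq_maxChainCard (Finset.univ.image q)
  have hq : ∀ a ∈ C, ∃ i, q i = a := fun a ha => by simpa using hC ha
  choose g hg using hq
  have hsub : (Finset.univ.filter fun i => tupleChainErase i q < tupleChain q) ⊆
      C.attach.image fun a => g a.1 a.2 := by
    intro i hi
    rw [Finset.mem_filter] at hi
    by_contra hiC
    refine absurd hi.2 (not_lt.2 ?_)
    change maxChainCard _ ≤ maxChainCard _
    rw [← h]
    refine card_le_maxChainCard (fun a ha => ?_) hc
    rw [Finset.mem_image]
    refine ⟨g a ha, ?_, hg a ha⟩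
    rw [Finset.mem_erase]
    exact ⟨fun e => hiC (Finset.mem_image.2 ⟨⟨a, ha⟩, Finset.mem_attach _ _, e⟩), Finset.mem_univ _⟩
  calc _ ≤ _ := Finset.card_le_card hsub
    _ ≤ C.attach.card := Finset.card_image_le
    _ = C.card := Finset.card_attach
    _ = _ := h

theorem sum_sub_tupleChainErase_le (H : ℕ → ℝ) (hH : Monotone H) (q : Fin k → α) :
    ∑ i, (H (tupleChain q) - H (tupleChainErase i q)) ≤
      tupleChain q * (H (tupleChain q) - H (tupleChain q - 1)) := by
  have h1 : ∀ i, H (tupleChain q) - H (tupleChainErase i q) =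
      if tupleChainErase i q < tupleChain q then H (tupleChain q) - H (tupleChain q - 1)
        else 0 := by
    intro i
    have h1 := tupleChain_le_tupleChainErase_add_one i q
    have h2 := tupleChainErase_le i q
    split_ifs with h
    · rw [show tupleChainErase i q = tupleChain q - 1 by omega]
    · rw [show tupleChainErase i q = tupleChain q by omega, sub_self]
  rw [Finset.sum_congr rfl fun i _ => h1 i, ← Finset.sum_filter, Finset.sum_const, nsmul_eq_mul]
  exact mul_le_mul_of_nonneg_right (by exact_mod_cast card_pivotal_le q)
    (sub_nonneg.2 (hH (Nat.sub_le _ _)))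

end FiniteChains

section Concentration

open scoped BigOperators

theorem expect_fin_cons {Q : Type*} [Fintype Q] {k : ℕ} (F : (Fin (k + 1) → Q) → ℝ) :
    𝔼 q, F q = 𝔼 r : Fin k → Q, 𝔼 v : Q, F (Fin.cons v r) := by
  rw [Finset.expect_comm, ← Finset.expect_product', Finset.univ_product_univ]
  exact (Fintype.expect_equiv (Fin.consEquiv fun _ : Fin (k + 1) => Q) _ _ fun p => rfl).symm

/-- A covariance inequality on finite product spaces. If each coordinate changes `f` by at most `1`
and `g i ≤ h` does not depend on the `i`-th coordinate, then the covariance of `h` and `f` under the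
uniform distribution is at most `∑ i, 𝔼 (h - g i)`. -/
theorem expect_mul_sub_le {Q : Type*} [Fintype Q] [Nonempty Q] [DecidableEq Q] {k : ℕ} :
    ∀ (f h : (Fin k → Q) → ℝ) (g : Fin k → (Fin k → Q) → ℝ),
      (∀ i q v, g i (Function.update q i v) = g i q) → (∀ i q, g i q ≤ h q) →
      (∀ i q v, f (Function.update q i v) ≤ f q + 1) →
      𝔼 q, h q * f q - (𝔼 q, h q) * 𝔼 q, f q ≤ ∑ i, 𝔼 q, (h q - g i q) := by
  induction k with
  | zero =>
    intro f h g _ _ _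
    simp
  | succ k ih =>
    intro f h g hg hgh hf
    have key := ih (fun r => 𝔼 v, f (Fin.cons v r)) (fun r => 𝔼 v, h (Fin.cons v r))
      (fun i r => 𝔼 v, g i.succ (Fin.cons v r))
      (fun i r w => by
        refine Finset.expect_congr rfl fun v _ => ?_
        rw [Fin.cons_update, hg])
      (fun i r => Finset.expect_le_expect fun v _ => hgh _ _)
      (fun i r w => by
        have : 𝔼 v, f (Fin.cons v r) + 1 = 𝔼 v : Q, (f (Fin.cons v r) + 1) := by
          rw [Finset.expect_add_distrib, Fintype.expect_const]
        rw [this]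
        refine Finset.expect_le_expect fun v _ => ?_
        rw [Fin.cons_update]
        exact hf _ _ _)
    have first : ∀ r : Fin k → Q,
        𝔼 v, h (Fin.cons v r) * f (Fin.cons v r) -
          (𝔼 v, h (Fin.cons v r)) * 𝔼 v, f (Fin.cons v r) ≤
        𝔼 v, (h (Fin.cons v r) - g 0 (Fin.cons v r)) := by
      intro r
      obtain ⟨v₀⟩ := ‹Nonempty Q›
      have hg0 : ∀ v, g 0 (Fin.cons v r) = g 0 (Fin.cons v₀ r) := fun v => by
        rw [← hg 0 (Fin.cons v₀ r) v, Fin.update_cons_zero]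
      set F := 𝔼 v, f (Fin.cons v r) with hF
      have hfF : ∀ v, f (Fin.cons v r) - F ≤ 1 := by
        intro v
        have : f (Fin.cons v r) - 1 ≤ F := by
          refine Finset.le_expect ⟨v, Finset.mem_univ _⟩ fun w _ => ?_
          have := hf 0 (Fin.cons w r) v
          rw [Fin.update_cons_zero] at this
          linarith
        linarith
      have e1 : 𝔼 v, h (Fin.cons v r) * f (Fin.cons v r) - (𝔼 v, h (Fin.cons v r)) * F =
          𝔼 v, (h (Fin.cons v r) - g 0 (Fin.cons v r)) * (f (Fin.cons v r) - F) := by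
        simp only [hg0, sub_mul, mul_sub, Finset.expect_sub_distrib, ← Finset.expect_mul,
          ← Finset.mul_expect, ← hF]
        rw [Finset.expect_const ⟨v₀, Finset.mem_univ _⟩]
        ring
      rw [e1]
      refine Finset.expect_le_expect fun v _ => ?_
      exact mul_le_of_le_one_right (sub_nonneg.2 (hgh _ _)) (hfF v)
    have first' := Finset.expect_le_expect (s := Finset.univ) fun r _ => first r
    rw [Finset.expect_sub_distrib] at first'
    simp only [expect_fin_cons, Fin.sum_univ_succ]
    simp only [← Finset.expect_sub_distrib] at key
    linarith

variable {α : Type*} [PartialOrder α] [Fintype α] [Nonempty α] [DecidableEq α]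

theorem expect_tupleChain_mul_le {k : ℕ} (H : ℕ → ℝ) (hH : Monotone H) :
    𝔼 q : Fin k → α, (tupleChain q : ℝ) * H (tupleChain q - 1) ≤
      (𝔼 q : Fin k → α, (tupleChain q : ℝ)) * 𝔼 q : Fin k → α, H (tupleChain q) := by
  have h1 := expect_mul_sub_le (Q := α) (k := k) (fun q => (tupleChain q : ℝ))
    (fun q => H (tupleChain q)) (fun i q => H (tupleChainErase i q))
    (fun i q v => by rw [tupleChainErase_update]) (fun i q => hH (tupleChainErase_le i q))
    (fun i q v => by exact_mod_cast tupleChain_update_le i q v)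
  rw [← Finset.expect_sum_comm] at h1
  have h2 := Finset.expect_le_expect (s := Finset.univ)
    fun (q : Fin k → α) _ => sum_sub_tupleChainErase_le H hH q
  simp only [mul_sub, Finset.expect_sub_distrib] at h2
  have h3 : 𝔼 q : Fin k → α, H (tupleChain q) * (tupleChain q : ℝ) =
    𝔼 q : Fin k → α, (tupleChain q : ℝ) * H (tupleChain q) :=
    Finset.expect_congr rfl fun q _ => mul_comm _ _
  linarith

/-- The factorial moments of the longest chain are bounded by the powers of its mean. -/
theorem expect_descFactorial_tupleChain_le {k : ℕ} (j : ℕ) :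
    𝔼 q : Fin k → α, ((tupleChain q).descFactorial j : ℝ) ≤
      (𝔼 q : Fin k → α, (tupleChain q : ℝ)) ^ j := by
  induction j with
  | zero => simp
  | succ j ih =>
    have h := expect_tupleChain_mul_le (α := α) (k := k) (fun z => (z.descFactorial j : ℝ))
      (fun a b hab => Nat.cast_le.2 (Nat.descFactorial_le j hab))
    have e : ∀ q : Fin k → α, ((tupleChain q).descFactorial (j + 1) : ℝ) =
        (tupleChain q : ℝ) * ((tupleChain q - 1).descFactorial j : ℝ) := by
      intro q
      cases h : tupleChain q with
      | zero => simp
      | succ n => rw [Nat.succ_descFactorial_succ]; simp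
    simp only [e]
    rw [pow_succ']
    exact h.trans (mul_le_mul_of_nonneg_left ih (Finset.expect_nonneg fun _ _ => by positivity))

/-- The longest chain among independent uniform points has exponential moments at most those of a
Poisson variable with the same mean. -/
theorem expect_pow_tupleChain_le {k : ℕ} {t : ℝ} (ht : 1 ≤ t) :
    𝔼 q : Fin k → α, t ^ tupleChain q ≤
      Real.exp ((t - 1) * 𝔼 q : Fin k → α, (tupleChain q : ℝ)) := by
  set μ := 𝔼 q : Fin k → α, (tupleChain q : ℝ) with hμ
  have hμ0 : 0 ≤ μ := Finset.expect_nonneg fun _ _ => by positivity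
  have e : ∀ q : Fin k → α, t ^ tupleChain q = ∑ j ∈ Finset.range (k + 1),
      (t - 1) ^ j / (j.factorial : ℝ) * ((tupleChain q).descFactorial j : ℝ) := by
    intro q
    have h1 : t ^ tupleChain q = ((t - 1) + 1) ^ tupleChain q := by simp
    rw [h1, add_pow, Finset.sum_subset (Finset.range_subset_range.2
      (Nat.succ_le_succ (tupleChain_le q)))]
    · refine Finset.sum_congr rfl fun j _ => ?_
      rw [Nat.descFactorial_eq_factorial_mul_choose, Nat.cast_mul]
      have := Nat.factorial_ne_zero j
      field_simp
      simp
    · intro j _ hj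
      rw [Nat.choose_eq_zero_of_lt (by simpa using hj)]
      simp
  simp only [e]
  rw [Finset.expect_sum_comm]
  refine le_trans (Finset.sum_le_sum fun j _ => ?_)
    (Real.sum_le_exp_of_nonneg (mul_nonneg (sub_nonneg.2 ht) hμ0) (k + 1))
  rw [← Finset.mul_expect, mul_pow, mul_div_right_comm]
  exact mul_le_mul_of_nonneg_left (expect_descFactorial_tupleChain_le j)
    (div_nonneg (pow_nonneg (sub_nonneg.2 ht) _) (by positivity))

end Concentration

section ChainLength

variable {d : ℕ}

theorem exists_isChain_of_le_chainLength {A : Set (Fin d → ℝ)} {m : ℕ}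
    (h : m ≤ chainLength d A) :
    ∃ C : Finset (Fin d → ℝ), ↑C ⊆ A ∧ IsChain (· ≤ ·) (C : Set (Fin d → ℝ)) ∧ m ≤ C.card := by
  set S := {n : ℕ | ∃ C : Finset (Fin d → ℝ),
    ↑C ⊆ A ∧ IsChain (· ≤ ·) (C : Set (Fin d → ℝ)) ∧ C.card = n} with hS
  have h0 : (0 : ℕ) ∈ S := ⟨∅, by simp⟩
  have hm : sSup S ∈ S := by
    by_cases hb : BddAbove S
    · exact Nat.sSup_mem ⟨0, h0⟩ hb
    · rwa [Nat.sSup_of_not_bddAbove hb]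
  obtain ⟨C, hC, hc, hcard⟩ := hm
  exact ⟨C, hC, hc, hcard ▸ h⟩

theorem card_le_chainLength {A : Set (Fin d → ℝ)} (hA : A.Finite) {C : Finset (Fin d → ℝ)}
    (hC : ↑C ⊆ A) (hc : IsChain (· ≤ ·) (C : Set (Fin d → ℝ))) : C.card ≤ chainLength d A := by
  refine le_csSup ⟨hA.toFinset.card, ?_⟩ ⟨C, hC, hc, rfl⟩
  rintro n ⟨D, hD, -, rfl⟩
  exact Finset.card_le_card fun z hz => hA.mem_toFinset.2 (hD hz)

end ChainLength

section Discretization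

/-- Product Bernoulli measures with odds `w q ≤ lam` are stochastically dominated by the one with
constant odds `lam`. -/
theorem sum_mul_prod_div_le {Q : Type*} [Fintype Q] [DecidableEq Q] {w : Q → ℝ} {lam : ℝ}
    (hw0 : ∀ q, 0 ≤ w q) (hw : ∀ q, w q ≤ lam) (hlam : 0 ≤ lam) {μ : Finset Q → ℝ}
    (hμ0 : 0 ≤ μ) (hμ : Monotone μ) :
    ∑ T, μ T * ((∏ q ∈ T, w q) / ∏ q, (1 + w q)) ≤
      ∑ T, μ T * (lam ^ T.card / (1 + lam) ^ Fintype.card Q) := by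
  have hsum : ∀ v : Q → ℝ, (∀ q, 0 ≤ v q) →
      ∑ T : Finset Q, (∏ q ∈ T, v q) / ∏ q, (1 + v q) = 1 := by
    intro v hv
    have hpos : 0 < ∏ q, (1 + v q) := Finset.prod_pos fun q _ => by linarith [hv q]
    rw [← Finset.sum_div, Finset.prod_one_add, Finset.powerset_univ, div_self]
    rw [← Finset.powerset_univ, ← Finset.prod_one_add]
    exact hpos.ne'
  have hconst : ∀ T : Finset Q, lam ^ T.card / (1 + lam) ^ Fintype.card Q =
      (∏ q ∈ T, lam) / ∏ q : Q, (1 + lam) := fun T => by simp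
  simp only [hconst]
  have hn : 0 ≤ ∏ q, (1 + w q) := Finset.prod_nonneg fun q _ => by linarith [hw0 q]
  have hn' : 0 ≤ ∏ q : Q, (1 + lam) := Finset.prod_nonneg fun q _ => by linarith
  refine holley (μ := μ) _ _ hμ0 (fun T => div_nonneg (Finset.prod_nonneg fun q _ => hw0 q) hn)
    (fun T => div_nonneg (Finset.prod_nonneg fun q _ => hlam) hn') hμ ?_ ?_
  · rw [hsum w hw0, hsum (fun _ => lam) fun _ => hlam]
  · intro A B
    rw [div_mul_div_comm, div_mul_div_comm]
    refine div_le_div_of_nonneg_right ?_ (mul_nonneg hn hn')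
    have e1 : ∏ q ∈ A, w q = (∏ q ∈ A ∩ B, w q) * ∏ q ∈ A \ B, w q :=
      (Finset.prod_inter_mul_prod_sdiff A B w).symm
    have e2 : ∏ q ∈ A ∪ B, lam = (∏ q ∈ A \ B, lam) * ∏ q ∈ B, lam := by
      rw [← Finset.sdiff_union_self_eq_union, Finset.prod_union Finset.sdiff_disjoint]
    rw [Finset.inf_eq_inter, Finset.sup_eq_union, e1, e2, mul_assoc]
    refine mul_le_mul_of_nonneg_left ?_ (Finset.prod_nonneg fun q _ => hw0 q)
    exact mul_le_mul_of_nonneg_right (Finset.prod_le_prod (fun q _ => hw0 q) fun q _ => hw q)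
      (Finset.prod_nonneg fun q _ => hlam)

theorem PoissonPP.measure_iInter_encard {d : ℕ} {Ω : Type*} [MeasurableSpace Ω] {P : Measure Ω}
    {g : (Fin d → ℝ) → ℝ} (X : PoissonPP d P g) {Q : Type*} [Fintype Q]
    {A : Q → Set (Fin d → ℝ)} (hA : ∀ q, MeasurableSet (A q))
    (hb : ∀ q, Bornology.IsBounded (A q)) (hd : Pairwise fun p q => Disjoint (A p) (A q))
    (k : Q → ℕ) :
    P (⋂ q, {ω | (X.pts ω ∩ A q).encard = k q}) =
      ∏ q, P {ω | (X.pts ω ∩ A q).encard = k q} := by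
  have e := (Fintype.equivFin Q).symm
  have h := X.indep _ (A ∘ e) (fun i => hA _) (fun i => hb _)
    (fun i j hij => hd (e.injective.ne hij)) (k ∘ e)
  rw [← e.prod_comp, ← e.surjective.iInter_comp]
  exact h

theorem PoissonPP.measure_one_lt_le {d : ℕ} {Ω : Type*} [MeasurableSpace Ω] {P : Measure Ω}
    [IsProbabilityMeasure P] {g : (Fin d → ℝ) → ℝ} (X : PoissonPP d P g)
    {A : Set (Fin d → ℝ)} (hA : MeasurableSet A) (hb : Bornology.IsBounded A)
    (h0 : 0 ≤ ∫ z in A, g z) :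
    P ({ω | (X.pts ω ∩ A).encard = (0 : ℕ)} ∪ {ω | (X.pts ω ∩ A).encard = (1 : ℕ)})ᶜ ≤
      ENNReal.ofReal ((∫ z in A, g z) ^ 2) := by
  set w := ∫ z in A, g z with hw
  have hdisj : Disjoint {ω | (X.pts ω ∩ A).encard = (0 : ℕ)}
      {ω | (X.pts ω ∩ A).encard = (1 : ℕ)} := by
    rw [Set.disjoint_left]
    intro ω h1 h2
    simp only [Set.mem_ofPred_eq] at h1 h2
    rw [h1] at h2
    simp at h2
  have hexp : 0 ≤ Real.exp (-w) := (Real.exp_pos _).le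
  rw [prob_compl_eq_one_sub ((X.measur A hA hb 0).union (X.measur A hA hb 1)),
    measure_union hdisj (X.measur A hA hb 1), X.poisson A hA hb, X.poisson A hA hb, ← hw,
    ← ENNReal.ofReal_add (by positivity) (by positivity), ← ENNReal.ofReal_one,
    ← ENNReal.ofReal_sub _ (by positivity)]
  refine ENNReal.ofReal_le_ofReal ?_
  simp only [pow_zero, pow_one, Nat.factorial_zero, Nat.factorial_one, Nat.cast_one, div_one,
    mul_one]
  nlinarith [Real.add_one_le_exp (-w), sq_nonneg w]

theorem PoissonPP.measure_le_chainLength_le {d : ℕ} {Ω : Type*} [MeasurableSpace Ω]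
    {P : Measure Ω} [IsProbabilityMeasure P] {g : (Fin d → ℝ) → ℝ} (X : PoissonPP d P g)
    {R : Set (Fin d → ℝ)} (hR : Bornology.IsBounded R)
    {Q : Type*} [PartialOrder Q] [Fintype Q] [DecidableEq Q]
    {φ : (Fin d → ℝ) → Q} (hφ : MonotoneOn φ R)
    (hmeas : ∀ q, MeasurableSet (R ∩ φ ⁻¹' {q})) {lam : ℝ} (hlam : 0 ≤ lam)
    (h0 : ∀ q, 0 ≤ ∫ z in R ∩ φ ⁻¹' {q}, g z) (h1 : ∀ q, ∫ z in R ∩ φ ⁻¹' {q}, g z ≤ lam)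
    (m : ℕ) :
    P {ω | m ≤ chainLength d (X.pts ω ∩ R)} ≤ ENNReal.ofReal (Fintype.card Q * lam ^ 2 +
      ∑ T : Finset Q, (if m ≤ maxChainCard T then 1 else 0) *
        (lam ^ T.card / (1 + lam) ^ Fintype.card Q)) := by
  set A : Q → Set (Fin d → ℝ) := fun q => R ∩ φ ⁻¹' {q} with hAdef
  set w : Q → ℝ := fun q => ∫ z in A q, g z with hw
  have hb : ∀ q, Bornology.IsBounded (A q) := fun q => hR.subset Set.inter_subset_left
  have hdisj : Pairwise fun p q => Disjoint (A p) (A q) := by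
    intro p q hpq
    rw [Set.disjoint_left]
    rintro z ⟨-, hz⟩ ⟨-, hz'⟩
    exact hpq (hz.symm.trans hz')
  set bad : Q → Set Ω := fun q =>
    ({ω | (X.pts ω ∩ A q).encard = (0 : ℕ)} ∪ {ω | (X.pts ω ∩ A q).encard = (1 : ℕ)})ᶜ with hbad
  set G : Finset Q → Set Ω := fun T =>
    ⋂ q, {ω | (X.pts ω ∩ A q).encard = ((if q ∈ T then 1 else 0 : ℕ) : ℕ∞)} with hG
  set E : Finset (Finset Q) := Finset.univ.filter fun T => m ≤ maxChainCard T with hE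
  have hcover : {ω | m ≤ chainLength d (X.pts ω ∩ R)} ⊆
      (⋃ q ∈ (Finset.univ : Finset Q), bad q) ∪ ⋃ T ∈ E, G T := by
    intro ω hω
    by_cases hω' : ω ∈ ⋃ q ∈ (Finset.univ : Finset Q), bad q
    · exact Or.inl hω'
    right
    have hcases : ∀ q, (X.pts ω ∩ A q).encard = 0 ∨ (X.pts ω ∩ A q).encard = 1 := by
      intro q
      by_contra hq
      refine hω' ?_
      simp only [Set.mem_iUnion]
      refine ⟨q, Finset.mem_univ _, ?_⟩
      simpa [hbad] using hq
    classical
    set T : Finset Q := Finset.univ.filter fun q => (X.pts ω ∩ A q).encard = 1 with hT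
    simp only [Set.mem_iUnion]
    refine ⟨T, ?_, ?_⟩
    · rw [hE, Finset.mem_filter]
      refine ⟨Finset.mem_univ _, ?_⟩
      obtain ⟨C, hC, hc, hmC⟩ := exists_isChain_of_le_chainLength hω
      have hne : ∀ z ∈ C, (X.pts ω ∩ A (φ z)).encard = 1 := by
        intro z hz
        refine (hcases (φ z)).resolve_left fun h => ?_
        rw [Set.encard_eq_zero] at h
        exact Set.notMem_empty z (h ▸ ⟨(hC hz).1, (hC hz).2, rfl⟩)
      have hinj : Set.InjOn φ (C : Set (Fin d → ℝ)) := by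
        intro z hz z' hz' hzz
        obtain ⟨a, ha⟩ := Set.encard_eq_one.1 (hne z hz)
        have e1 : z ∈ ({a} : Set (Fin d → ℝ)) := ha ▸ ⟨(hC hz).1, (hC hz).2, rfl⟩
        have e2 : z' ∈ ({a} : Set (Fin d → ℝ)) := ha ▸ ⟨(hC hz').1, (hC hz').2, hzz.symm⟩
        exact (Set.mem_singleton_iff.1 e1).trans (Set.mem_singleton_iff.1 e2).symm
      rw [← Finset.card_image_of_injOn hinj] at hmC
      refine hmC.trans (card_le_maxChainCard ?_ ?_)
      · intro q hq
        obtain ⟨z, hz, rfl⟩ := Finset.mem_image.1 hq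
        exact Finset.mem_filter.2 ⟨Finset.mem_univ _, hne z hz⟩
      · intro p hp q hq hpq
        simp only [Finset.coe_image, Set.mem_image] at hp hq
        obtain ⟨z, hz, rfl⟩ := hp
        obtain ⟨z', hz', rfl⟩ := hq
        exact (hc.total hz hz').imp (hφ (hC hz).2 (hC hz').2) (hφ (hC hz').2 (hC hz).2)
    · rw [hG]
      simp only [Set.mem_iInter, Set.mem_ofPred_eq]
      intro q
      by_cases hq : (X.pts ω ∩ A q).encard = 1
      · have hqT : q ∈ T := by rw [hT, Finset.mem_filter]; exact ⟨Finset.mem_univ _, hq⟩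
        rw [if_pos hqT, hq]; rfl
      · have hqT : q ∉ T := by rw [hT, Finset.mem_filter]; exact fun h => hq h.2
        rw [if_neg hqT, (hcases q).resolve_right hq]; rfl
  have hPG : ∀ T, P (G T) ≤ ENNReal.ofReal ((∏ q ∈ T, w q) / ∏ q, (1 + w q)) := by
    intro T
    rw [hG, X.measure_iInter_encard hmeas hb hdisj,
      Finset.prod_congr rfl fun q _ => X.poisson (A q) (hmeas q) (hb q) _,
      ← ENNReal.ofReal_prod_of_nonneg]
    · refine ENNReal.ofReal_le_ofReal ?_
      have e : ∏ q ∈ T, w q = ∏ q, w q ^ (if q ∈ T then 1 else 0 : ℕ) := by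
        rw [← Finset.prod_subset (Finset.subset_univ T)]
        · exact Finset.prod_congr rfl fun q hq => by simp [hq]
        · intro q _ hq
          simp [hq]
      rw [e, ← Finset.prod_div_distrib]
      refine Finset.prod_le_prod (fun q _ => ?_) fun q _ => ?_
      · have := pow_nonneg (h0 q) (if q ∈ T then 1 else 0 : ℕ)
        positivity
      · have hwq : 0 ≤ w q := h0 q
        have hf : (((if q ∈ T then 1 else 0 : ℕ)).factorial : ℝ) = 1 := by
          split_ifs <;> simp
        rw [hf, div_one, mul_comm, div_eq_mul_inv, Real.exp_neg]
        refine mul_le_mul_of_nonneg_left ?_ (pow_nonneg hwq _)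
        exact inv_anti₀ (by linarith) (by linarith [Real.add_one_le_exp (w q)])
    · intro q _
      have := pow_nonneg (h0 q) (if q ∈ T then 1 else 0 : ℕ)
      positivity
  have hdom := sum_mul_prod_div_le (w := w) h0 h1 hlam
    (μ := fun T => if m ≤ maxChainCard T then 1 else 0)
    (fun T => by dsimp only [Pi.zero_apply]; split_ifs <;> norm_num)
    (fun S T hST => by
      dsimp only
      split_ifs with a b b
      · exact le_rfl
      · exact absurd (a.trans (maxChainCard_mono hST)) b
      · exact zero_le_one
      · exact le_rfl)
  have hnn : ∀ T : Finset Q, 0 ≤ (∏ q ∈ T, w q) / ∏ q, (1 + w q) := fun T =>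
    div_nonneg (Finset.prod_nonneg fun q _ => h0 q)
      (Finset.prod_nonneg fun q _ => add_nonneg zero_le_one (h0 q))
  calc P {ω | m ≤ chainLength d (X.pts ω ∩ R)}
      ≤ P (⋃ q ∈ (Finset.univ : Finset Q), bad q) + P (⋃ T ∈ E, G T) :=
        (measure_mono hcover).trans (measure_union_le _ _)
    _ ≤ ∑ q, P (bad q) + ∑ T ∈ E, P (G T) :=
        add_le_add (measure_biUnion_finset_le _ _) (measure_biUnion_finset_le _ _)
    _ ≤ ∑ q : Q, ENNReal.ofReal (lam ^ 2) +
          ∑ T ∈ E, ENNReal.ofReal ((∏ q ∈ T, w q) / ∏ q, (1 + w q)) := by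
        refine add_le_add (Finset.sum_le_sum fun q _ => ?_) (Finset.sum_le_sum fun T _ => hPG T)
        exact (X.measure_one_lt_le (hmeas q) (hb q) (h0 q)).trans
          (ENNReal.ofReal_le_ofReal (pow_le_pow_left₀ (h0 q) (h1 q) 2))
    _ = ENNReal.ofReal (Fintype.card Q * lam ^ 2 +
          ∑ T ∈ E, (∏ q ∈ T, w q) / ∏ q, (1 + w q)) := by
        rw [← ENNReal.ofReal_sum_of_nonneg fun q _ => sq_nonneg lam,
          ← ENNReal.ofReal_sum_of_nonneg fun T _ => hnn T, ← ENNReal.ofReal_add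
            (Finset.sum_nonneg fun q _ => sq_nonneg lam) (Finset.sum_nonneg fun T _ => hnn T)]
        simp
    _ ≤ _ := by
        refine ENNReal.ofReal_le_ofReal (add_le_add_right (le_trans (le_of_eq ?_) hdom) _)
        rw [hE, Finset.sum_filter]
        exact Finset.sum_congr rfl fun T _ => by split_ifs <;> simp

open scoped BigOperators in
/-- Exponential Markov inequality for the longest chain of a Bernoulli subset, in terms of tuples of
independent uniform points. -/
theorem sum_pow_card_le {Q : Type*} [PartialOrder Q] [Fintype Q] [Nonempty Q] [DecidableEq Q]
    {lam t : ℝ} (hlam : 0 ≤ lam) (ht : 1 ≤ t) (m : ℕ) :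
    ∑ T : Finset Q, (if m ≤ maxChainCard T then 1 else 0) * lam ^ T.card ≤
      (t ^ m)⁻¹ * ∑ k ∈ Finset.range (Fintype.card Q + 1),
        (Fintype.card Q * lam) ^ k / k.factorial *
          Real.exp ((t - 1) * 𝔼 q : Fin k → Q, (tupleChain q : ℝ)) := by
  have ht0 : 0 < t := by linarith
  have step1 : ∀ T : Finset Q, (if m ≤ maxChainCard T then (1 : ℝ) else 0) * lam ^ T.card ≤
      (t ^ m)⁻¹ * (t ^ maxChainCard T * lam ^ T.card) := by
    intro T
    rw [← mul_assoc]
    refine mul_le_mul_of_nonneg_right ?_ (by positivity)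
    split_ifs with h
    · rw [inv_mul_eq_div, one_le_div (by positivity)]
      exact pow_le_pow_right₀ ht h
    · positivity
  refine (Finset.sum_le_sum fun T _ => step1 T).trans ?_
  rw [← Finset.mul_sum]
  refine mul_le_mul_of_nonneg_left ?_ (by positivity)
  rw [← Finset.sum_fiberwise_of_maps_to (s := Finset.univ)
    (t := Finset.range (Fintype.card Q + 1)) (g := Finset.card)
    (fun T _ => Finset.mem_range.2 (Nat.lt_succ_of_le (Finset.card_le_univ T)))]
  refine Finset.sum_le_sum fun k _ => ?_
  have hfact : (0 : ℝ) < k.factorial := by exact_mod_cast k.factorial_pos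
  have hcard : ∀ T : Finset Q, T.card = k →
      k.factorial ≤ (Finset.univ.filter fun q : Fin k → Q => Finset.univ.image q = T).card := by
    intro T hT
    have e : Fin k ≃ T := (finCongr hT.symm).trans T.equivFin.symm
    have h1 : Fintype.card (Fin k ≃ T) = k.factorial := by
      rw [Fintype.card_equiv e, Fintype.card_fin]
    rw [← h1, ← Finset.card_univ]
    refine Finset.card_le_card_of_injOn (fun σ i => (σ i : Q)) (fun σ _ => ?_) ?_
    · simp only [Finset.coe_filter, Finset.mem_univ, true_and, Set.mem_ofPred_eq]
      ext a
      simp only [Finset.mem_image, Finset.mem_univ, true_and]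
      exact ⟨fun ⟨i, hi⟩ => hi ▸ (σ i).2, fun ha => ⟨σ.symm ⟨a, ha⟩, by simp⟩⟩
    · intro σ _ τ _ h
      ext i
      exact congrFun h i
  have step2 : (k.factorial : ℝ) * ∑ T : Finset Q with T.card = k, t ^ maxChainCard T ≤
      ∑ q : Fin k → Q, t ^ tupleChain q := by
    rw [Finset.mul_sum]
    calc ∑ T : Finset Q with T.card = k, (k.factorial : ℝ) * t ^ maxChainCard T
        ≤ ∑ T : Finset Q with T.card = k,
            ∑ q : Fin k → Q with Finset.univ.image q = T, t ^ tupleChain q := by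
          refine Finset.sum_le_sum fun T hT => ?_
          rw [Finset.sum_congr rfl fun q hq => by
            rw [tupleChain, (Finset.mem_filter.1 hq).2], Finset.sum_const, nsmul_eq_mul]
          exact mul_le_mul_of_nonneg_right
            (by exact_mod_cast hcard T (Finset.mem_filter.1 hT).2) (by positivity)
      _ ≤ ∑ T : Finset Q, ∑ q : Fin k → Q with Finset.univ.image q = T, t ^ tupleChain q :=
          Finset.sum_le_sum_of_subset_of_nonneg (Finset.subset_univ _)
            fun T _ _ => Finset.sum_nonneg fun q _ => by positivity
      _ = _ := Finset.sum_fiberwise _ _ _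
  have hN : (0 : ℝ) < (Fintype.card Q : ℝ) ^ k := by
    have : 0 < Fintype.card Q := Fintype.card_pos
    positivity
  have step3 := expect_pow_tupleChain_le (α := Q) (k := k) ht
  rw [Fintype.expect_eq_sum_div_card, Fintype.card_fun, Fintype.card_fin, Nat.cast_pow,
    div_le_iff₀ hN] at step3
  have step4 : ∑ T : Finset Q with T.card = k, t ^ maxChainCard T * lam ^ T.card =
      lam ^ k * ∑ T : Finset Q with T.card = k, t ^ maxChainCard T := by
    rw [Finset.mul_sum]
    exact Finset.sum_congr rfl fun T hT => by rw [(Finset.mem_filter.1 hT).2, mul_comm]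
  rw [step4, mul_pow]
  calc lam ^ k * ∑ T : Finset Q with T.card = k, t ^ maxChainCard T
      ≤ lam ^ k * ((Real.exp ((t - 1) * 𝔼 q : Fin k → Q, (tupleChain q : ℝ)) *
          (Fintype.card Q : ℝ) ^ k) / k.factorial) := by
        refine mul_le_mul_of_nonneg_left ?_ (by positivity)
        rw [le_div_iff₀ hfact, mul_comm]
        exact step2.trans step3
    _ = _ := by ring

end Discretization

section Cube

open scoped BigOperators

theorem exists_index_finset_of_isChain {α : Type*} [PartialOrder α] {k : ℕ} {X : Fin k → α}
    {C : Finset α} (hC : ∀ a ∈ C, ∃ i, X i = a) (hc : IsChain (· ≤ ·) (C : Set α)) :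
    ∃ I : Finset (Fin k), I.card = C.card ∧
      ∀ a ∈ I, ∀ b ∈ I, a ≠ b → X a < X b ∨ X b < X a := by
  classical
  choose g hg using hC
  have hinj : Function.Injective fun a : C => g a.1 a.2 := by
    intro a b h
    have h' : g a.1 a.2 = g b.1 b.2 := h
    rw [Subtype.ext_iff, ← hg a.1 a.2, ← hg b.1 b.2, h']
  refine ⟨C.attach.image fun a => g a.1 a.2, ?_, ?_⟩
  · rw [Finset.card_image_of_injective _ hinj, Finset.card_attach]
  · intro a ha b hb hab
    obtain ⟨⟨x, hx⟩, -, rfl⟩ := Finset.mem_image.1 ha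
    obtain ⟨⟨y, hy⟩, -, rfl⟩ := Finset.mem_image.1 hb
    have hxy : x ≠ y := by
      rintro rfl
      exact hab rfl
    simp only [hg]
    exact (hc hx hy hxy).imp (lt_of_le_of_ne · hxy) (lt_of_le_of_ne · hxy.symm)

variable {d : ℕ}

theorem le_chainLength_range_iff {k m : ℕ} {X : Fin k → Fin d → ℝ} :
    m ≤ chainLength d (Set.range X) ↔ ∃ I : Finset (Fin k), m ≤ I.card ∧
      ∀ a ∈ I, ∀ b ∈ I, a ≠ b → X a < X b ∨ X b < X a := by
  constructor
  · intro h
    obtain ⟨C, hC, hc, hm⟩ := exists_isChain_of_le_chainLength h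
    obtain ⟨I, hI, h⟩ := exists_index_finset_of_isChain (fun a ha => hC ha) hc
    exact ⟨I, hI ▸ hm, h⟩
  · rintro ⟨I, hm, hI⟩
    have hinj : Set.InjOn X (I : Set (Fin k)) := by
      intro a ha b hb hab
      by_contra hne
      rcases hI a ha b hb hne with h | h
      · exact h.ne hab
      · exact h.ne hab.symm
    rw [← Finset.card_image_of_injOn hinj] at hm
    refine hm.trans (card_le_chainLength (Set.finite_range X) ?_ ?_)
    · intro z hz
      obtain ⟨a, -, rfl⟩ := Finset.mem_image.1 (Finset.mem_coe.1 hz)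
      exact ⟨a, rfl⟩
    · intro z hz w hw hzw
      obtain ⟨a, ha, rfl⟩ := Finset.mem_image.1 (Finset.mem_coe.1 hz)
      obtain ⟨b, hb, rfl⟩ := Finset.mem_image.1 (Finset.mem_coe.1 hw)
      exact (hI a ha b hb fun h => hzw (h ▸ rfl)).imp le_of_lt le_of_lt

theorem chainLength_range_le {k : ℕ} (X : Fin k → Fin d → ℝ) :
    chainLength d (Set.range X) ≤ k := by
  obtain ⟨I, hI, -⟩ := le_chainLength_range_iff.1 (le_refl (chainLength d (Set.range X)))
  exact hI.trans ((Finset.card_le_univ I).trans (by simp))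

theorem measurable_chainLength_range (k : ℕ) :
    Measurable fun X : Fin k → Fin d → ℝ => chainLength d (Set.range X) := by
  have hle : ∀ a b : Fin k, MeasurableSet {X : Fin k → Fin d → ℝ | X a ≤ X b} := fun a b =>
    measurableSet_le (measurable_pi_apply a) (measurable_pi_apply b)
  have hlt : ∀ a b : Fin k, MeasurableSet {X : Fin k → Fin d → ℝ | X a < X b} := fun a b => by
    simp only [lt_iff_le_not_ge]
    exact (hle a b).inter (hle b a).compl
  refine measurable_of_Ici fun m => ?_
  have : (fun X : Fin k → Fin d → ℝ => chainLength d (Set.range X)) ⁻¹' Set.Ici m =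
      ⋃ I : Finset (Fin k), ⋃ _ : m ≤ I.card, ⋂ a ∈ I, ⋂ b ∈ I, ⋂ _ : a ≠ b,
        ({X | X a < X b} ∪ {X | X b < X a}) := by
    ext X
    simp only [Set.mem_preimage, Set.mem_Ici, le_chainLength_range_iff, Set.mem_iUnion,
      Set.mem_iInter, Set.mem_union, Set.mem_ofPred_eq, exists_prop]
  rw [this]
  exact MeasurableSet.iUnion fun I => MeasurableSet.iUnion fun _ =>
    MeasurableSet.iInter fun a => MeasurableSet.iInter fun _ => MeasurableSet.iInter fun b =>
    MeasurableSet.iInter fun _ => MeasurableSet.iInter fun _ => (hlt a b).union (hlt b a)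

/-- The cell of index `q` in the partition of the unit cube into `(K + 1) ^ d` cubes. -/
def unitCell (K : ℕ) (q : Fin d → Fin (K + 1)) : Set (Fin d → ℝ) :=
  Set.univ.pi fun i => Set.Ico ((q i : ℝ) / (K + 1)) (((q i : ℝ) + 1) / (K + 1))

theorem volume_restrict_unitCell (K : ℕ) (q : Fin d → Fin (K + 1)) :
    volume.restrict (Set.Icc (0 : Fin d → ℝ) 1) (unitCell K q) =
      ENNReal.ofReal (((K : ℝ) + 1) ^ d)⁻¹ := by
  have hK : (0 : ℝ) < (K : ℝ) + 1 := by positivity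
  have hsub : unitCell K q ⊆ Set.Icc (0 : Fin d → ℝ) 1 := by
    intro z hz
    refine ⟨fun i => ?_, fun i => ?_⟩
    · exact le_trans (by dsimp only [Pi.zero_apply]; positivity) (hz i (Set.mem_univ i)).1
    · refine (hz i (Set.mem_univ i)).2.le.trans ?_
      rw [div_le_iff₀ hK, Pi.one_apply, one_mul]
      exact_mod_cast (q i).2
  have hm : MeasurableSet (unitCell K q) := MeasurableSet.univ_pi fun i => measurableSet_Ico
  rw [Measure.restrict_apply hm, Set.inter_eq_left.2 hsub, unitCell, Real.volume_pi_Ico,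
    ← ENNReal.ofReal_prod_of_nonneg]
  · congr 1
    rw [Finset.prod_congr rfl fun i _ => show ((q i : ℝ) + 1) / (K + 1) - (q i : ℝ) / (K + 1) =
      ((K : ℝ) + 1)⁻¹ by field_simp; ring]
    simp
  · intro i _
    rw [sub_nonneg]
    gcongr
    linarith

theorem lt_of_mem_Ico_div {K : ℕ} {p q : Fin (K + 1)} {x y : ℝ}
    (hx : x ∈ Set.Ico ((p : ℝ) / (K + 1)) (((p : ℝ) + 1) / (K + 1)))
    (hy : y ∈ Set.Ico ((q : ℝ) / (K + 1)) (((q : ℝ) + 1) / (K + 1))) (h : p < q) : x < y := by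
  refine hx.2.trans_le (le_trans ?_ hy.1)
  gcongr
  exact_mod_cast h

theorem pairwise_disjoint_unitCell (K : ℕ) :
    Pairwise fun p q : Fin d → Fin (K + 1) => Disjoint (unitCell K p) (unitCell K q) := by
  intro p q hpq
  rw [Set.disjoint_left]
  intro z hp hq
  obtain ⟨i, hi⟩ := Function.ne_iff.1 hpq
  rcases lt_or_gt_of_ne hi with h | h
  · exact lt_irrefl _ (lt_of_mem_Ico_div (hp i (Set.mem_univ i)) (hq i (Set.mem_univ i)) h)
  · exact lt_irrefl _ (lt_of_mem_Ico_div (hq i (Set.mem_univ i)) (hp i (Set.mem_univ i)) h)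

/-- No two entries of the tuple of cells lie in a common slab of the grid. -/
def NoTie {k K : ℕ} (q : Fin k → Fin d → Fin (K + 1)) : Prop :=
  ∀ a b, a ≠ b → ∀ i, q a i ≠ q b i

theorem tupleChain_le_chainLength_range {k K : ℕ} {q : Fin k → Fin d → Fin (K + 1)}
    (hq : NoTie q) {X : Fin k → Fin d → ℝ} (hX : ∀ a, X a ∈ unitCell K (q a)) :
    tupleChain q ≤ chainLength d (Set.range X) := by
  obtain ⟨C, hC, hc, hcard⟩ := exists_isChain_card_eq_maxChainCard (Finset.univ.image q)
  obtain ⟨I, hI, hlt⟩ := exists_index_finset_of_isChain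
    (fun a ha => by simpa using hC ha) hc
  refine le_chainLength_range_iff.2 ⟨I, (hI.trans hcard).ge, fun a ha b hb hab => ?_⟩
  have key : ∀ a b, a ≠ b → q a < q b → X a < X b := by
    intro a b hab h
    rw [Pi.lt_def] at h ⊢
    have hlt : ∀ i, X a i < X b i := fun i =>
      lt_of_mem_Ico_div (hX a i (Set.mem_univ i)) (hX b i (Set.mem_univ i))
        (lt_of_le_of_ne (h.1 i) (hq a b hab i))
    exact ⟨fun i => (hlt i).le, h.2.imp fun i _ => hlt i⟩
  exact (hlt a ha b hb hab).imp (key a b hab) (key b a hab.symm)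

open Classical in
theorem card_not_noTie_mul_le (d k K : ℕ) :
    (Finset.univ.filter fun q : Fin k → Fin d → Fin (K + 1) => ¬ NoTie q).card * (K + 1) ≤
      k * k * d * ((K + 1) ^ d) ^ k := by
  have hone : ∀ (a b : Fin k) (i : Fin d), a ≠ b →
      (Finset.univ.filter fun q : Fin k → Fin d → Fin (K + 1) => q a i = q b i).card * (K + 1) ≤
        ((K + 1) ^ d) ^ k := by
    intro a b i hab
    have h1 : ((K + 1) ^ d) ^ k = Fintype.card (Fin k → Fin d → Fin (K + 1)) := by simp
    have h2 : (Finset.univ.filter fun q : Fin k → Fin d → Fin (K + 1) =>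
        q a i = q b i).card * (K + 1) =
        ((Finset.univ.filter fun q : Fin k → Fin d → Fin (K + 1) => q a i = q b i) ×ˢ
          (Finset.univ : Finset (Fin (K + 1)))).card := by
      rw [Finset.card_product, Finset.card_univ (α := Fin (K + 1)), Fintype.card_fin]
    rw [h1, h2, ← Finset.card_univ]
    refine Finset.card_le_card_of_injOn
      (fun p => Function.update p.1 a (Function.update (p.1 a) i p.2))
      (fun _ _ => Finset.mem_univ _) ?_
    rintro ⟨q, v⟩ hq ⟨r, w⟩ hr h
    have hq' : q a i = q b i := by simpa using hq
    have hr' : r a i = r b i := by simpa using hr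
    have hne : ∀ c ≠ a, q c = r c := fun c hc => by
      simpa [hc] using congrFun h c
    have ha : Function.update (q a) i v = Function.update (r a) i w := by
      simpa using congrFun h a
    have hv : v = w := by simpa using congrFun ha i
    have hqr : q = r := by
      funext c
      by_cases hc : c = a
      · subst hc
        funext j
        by_cases hj : j = i
        · subst hj
          rw [hq', hr', hne b hab.symm]
        · simpa [hj] using congrFun ha j
      · exact hne c hc
    rw [hqr, hv]
  have hsub : (Finset.univ.filter fun q : Fin k → Fin d → Fin (K + 1) => ¬ NoTie q) ⊆
      (Finset.univ.filter fun p : Fin k × Fin k × Fin d => p.1 ≠ p.2.1).biUnion fun p =>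
        Finset.univ.filter fun q : Fin k → Fin d → Fin (K + 1) => q p.1 p.2.2 = q p.2.1 p.2.2 := by
    intro q hq
    have hq := (Finset.mem_filter.1 hq).2
    unfold NoTie at hq
    push Not at hq
    obtain ⟨a, b, hab, i, hi⟩ := hq
    rw [Finset.mem_biUnion]
    exact ⟨(a, b, i), by simp [hab], by simp [hi]⟩
  calc _ ≤ (∑ p : Fin k × Fin k × Fin d with p.1 ≠ p.2.1,
          (Finset.univ.filter fun q : Fin k → Fin d → Fin (K + 1) =>
            q p.1 p.2.2 = q p.2.1 p.2.2).card) * (K + 1) :=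
        Nat.mul_le_mul_right _ ((Finset.card_le_card hsub).trans Finset.card_biUnion_le)
    _ ≤ ∑ p : Fin k × Fin k × Fin d with p.1 ≠ p.2.1, ((K + 1) ^ d) ^ k := by
        rw [Finset.sum_mul]
        exact Finset.sum_le_sum fun p hp => hone _ _ _ (Finset.mem_filter.1 hp).2
    _ ≤ ∑ p : Fin k × Fin k × Fin d, ((K + 1) ^ d) ^ k :=
        Finset.sum_le_sum_of_subset (Finset.subset_univ _)
    _ = _ := by simp [mul_assoc]

open Classical in
theorem sum_noTie_le_BWexpect (d k K : ℕ) :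
    (∑ q : Fin k → Fin d → Fin (K + 1) with NoTie q, (tupleChain q : ℝ)) /
      (((K : ℝ) + 1) ^ d) ^ k ≤ BWexpect d k := by
  set μ : Measure (Fin k → Fin d → ℝ) :=
    Measure.pi fun _ => volume.restrict (Set.Icc (0 : Fin d → ℝ) 1) with hμ
  have : IsFiniteMeasure (volume.restrict (Set.Icc (0 : Fin d → ℝ) 1)) :=
    ⟨by rw [Measure.restrict_apply_univ]; exact isCompact_Icc.measure_lt_top⟩
  set s : (Fin k → Fin d → Fin (K + 1)) → Set (Fin k → Fin d → ℝ) :=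
    fun q => Set.univ.pi fun a => unitCell K (q a) with hs
  have hcell : ∀ q : Fin d → Fin (K + 1), MeasurableSet (unitCell K q) := fun q =>
    MeasurableSet.univ_pi fun i => measurableSet_Ico
  have hsm : ∀ q, MeasurableSet (s q) := fun q => MeasurableSet.univ_pi fun a => hcell _
  have hsμ : ∀ q, μ.real (s q) = ((((K : ℝ) + 1) ^ d) ^ k)⁻¹ := by
    intro q
    rw [Measure.real, hμ, hs, Measure.pi_pi]
    simp only [volume_restrict_unitCell, Finset.prod_const, Finset.card_univ, Fintype.card_fin]
    rw [ENNReal.toReal_pow, ENNReal.toReal_ofReal (by positivity), inv_pow]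
  have hdisj : Pairwise fun p q => Disjoint (s p) (s q) := by
    intro p q hpq
    obtain ⟨a, ha⟩ := Function.ne_iff.1 hpq
    exact Set.disjoint_univ_pi.2 ⟨a, pairwise_disjoint_unitCell K ha⟩
  have hXint : Integrable (fun X => (chainLength d (Set.range X) : ℝ)) μ := by
    refine Integrable.of_bound
      (measurable_from_top.comp (measurable_chainLength_range k)).aestronglyMeasurable k ?_
    refine Filter.Eventually.of_forall fun X => ?_
    rw [Real.norm_natCast]
    exact_mod_cast chainLength_range_le X
  calc (∑ q : Fin k → Fin d → Fin (K + 1) with NoTie q, (tupleChain q : ℝ)) /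
        (((K : ℝ) + 1) ^ d) ^ k
      = ∑ q : Fin k → Fin d → Fin (K + 1) with NoTie q, (tupleChain q : ℝ) * μ.real (s q) := by
        rw [Finset.sum_div]
        exact Finset.sum_congr rfl fun q _ => by rw [hsμ, div_eq_mul_inv]
    _ ≤ ∑ q : Fin k → Fin d → Fin (K + 1) with NoTie q,
          ∫ X in s q, (chainLength d (Set.range X) : ℝ) ∂μ := by
        refine Finset.sum_le_sum fun q hq => ?_
        refine setIntegral_ge_of_const_le_real (hsm q) (measure_ne_top μ _) (fun X hX => ?_)
          hXint.integrableOn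
        exact_mod_cast tupleChain_le_chainLength_range (Finset.mem_filter.1 hq).2
          fun a => hX a (Set.mem_univ a)
    _ = ∫ X in ⋃ q ∈ Finset.univ.filter fun q : Fin k → Fin d → Fin (K + 1) => NoTie q, s q,
          (chainLength d (Set.range X) : ℝ) ∂μ :=
        (integral_biUnion_finset _ (fun q _ => hsm q) (fun p _ q _ hpq => hdisj hpq)
          fun q _ => hXint.integrableOn).symm
    _ ≤ BWexpect d k :=
        setIntegral_le_integral hXint (Filter.Eventually.of_forall fun X => by positivity)

theorem expect_tupleChain_le_BWexpect (d k K : ℕ) :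
    𝔼 q : Fin k → Fin d → Fin (K + 1), (tupleChain q : ℝ) ≤
      BWexpect d k + k ^ 3 * d / (K + 1) := by
  classical
  have hN : (0 : ℝ) < (((K : ℝ) + 1) ^ d) ^ k := by positivity
  have hcard : (Fintype.card (Fin k → Fin d → Fin (K + 1)) : ℝ) = (((K : ℝ) + 1) ^ d) ^ k := by
    simp
  rw [Fintype.expect_eq_sum_div_card, hcard,
    ← Finset.sum_filter_add_sum_filter_not Finset.univ NoTie, add_div]
  refine add_le_add (sum_noTie_le_BWexpect d k K) ?_
  rw [div_le_div_iff₀ hN (by positivity)]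
  have h1 : ∑ q : Fin k → Fin d → Fin (K + 1) with ¬ NoTie q, (tupleChain q : ℝ) ≤
      ((Finset.univ.filter fun q : Fin k → Fin d → Fin (K + 1) => ¬ NoTie q).card : ℝ) * k := by
    rw [← nsmul_eq_mul]
    exact Finset.sum_le_card_nsmul _ _ _ fun q _ => by exact_mod_cast tupleChain_le q
  have h2 : ((Finset.univ.filter fun q : Fin k → Fin d → Fin (K + 1) => ¬ NoTie q).card : ℝ) *
      (K + 1) ≤ k * k * d * (((K : ℝ) + 1) ^ d) ^ k := by
    exact_mod_cast card_not_noTie_mul_le d k K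
  calc _ ≤ ((Finset.univ.filter fun q : Fin k → Fin d → Fin (K + 1) => ¬ NoTie q).card : ℝ) * k *
        (K + 1) := mul_le_mul_of_nonneg_right h1 (by positivity)
    _ = k * (((Finset.univ.filter fun q : Fin k → Fin d → Fin (K + 1) => ¬ NoTie q).card : ℝ) *
        (K + 1)) := by ring
    _ ≤ k * (k * k * d * (((K : ℝ) + 1) ^ d) ^ k) :=
        mul_le_mul_of_nonneg_left h2 (by positivity)
    _ = _ := by ring

end Cube

/-- The cell of the grid subdividing `[a, b]` into `(K + 1) ^ d` equal boxes in which `z` lies. -/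
def gridIndex {d : ℕ} (a b : Fin d → ℝ) (K : ℕ) (z : Fin d → ℝ) : Fin d → Fin (K + 1) :=
  fun i => ⟨min K ⌊(K + 1) * (z i - a i) / (b i - a i)⌋₊, by omega⟩

theorem gridIndex_monotone {d : ℕ} {a b : Fin d → ℝ} (hab : a ≤ b) (K : ℕ) :
    Monotone (gridIndex a b K) := by
  intro z w hzw i
  simp only [gridIndex, Fin.mk_le_mk]
  refine min_le_min_left _ (Nat.floor_mono ?_)
  have := sub_nonneg.2 (hab i)
  have := hzw i
  gcongr

theorem measurableSet_gridIndex_preimage {d : ℕ} (a b : Fin d → ℝ) (K : ℕ)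
    (q : Fin d → Fin (K + 1)) : MeasurableSet (gridIndex a b K ⁻¹' {q}) := by
  have h : gridIndex a b K ⁻¹' {q} = ⋂ i, {z : Fin d → ℝ |
      min K ⌊(K + 1) * (z i - a i) / (b i - a i)⌋₊ = (q i : ℕ)} := by
    ext z
    simp [gridIndex, funext_iff, Fin.ext_iff]
  rw [h]
  refine MeasurableSet.iInter fun i => measurableSet_eq_fun ?_ measurable_const
  exact measurable_const.min (Nat.measurable_floor.comp (by fun_prop))

theorem Icc_inter_gridIndex_preimage_subset {d : ℕ} {a b : Fin d → ℝ} (K : ℕ)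
    (q : Fin d → Fin (K + 1)) :
    Set.Icc a b ∩ gridIndex a b K ⁻¹' {q} ⊆
      Set.Icc (fun i => a i + (q i : ℕ) * ((b i - a i) / (K + 1)))
        (fun i => a i + ((q i : ℕ) + 1) * ((b i - a i) / (K + 1))) := by
  rintro z ⟨⟨haz, hzb⟩, rfl⟩
  have key : ∀ i, a i + (gridIndex a b K z i : ℕ) * ((b i - a i) / (K + 1)) ≤ z i ∧
      z i ≤ a i + ((gridIndex a b K z i : ℕ) + 1) * ((b i - a i) / (K + 1)) := by
    intro i
    have h1 := haz i
    have h2 := hzb i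
    rcases (h1.trans h2).eq_or_lt with h | h
    · have : z i = a i := le_antisymm (h2.trans h.ge) h1
      simp [this, ← h]
    have hb : 0 < b i - a i := sub_pos.2 h
    have hh : 0 < (b i - a i) / (K + 1) := by positivity
    obtain ⟨x, hx⟩ : ∃ x, x = (K + 1) * (z i - a i) / (b i - a i) := ⟨_, rfl⟩
    have hz : z i = a i + x * ((b i - a i) / (K + 1)) := by
      rw [hx]; field_simp; ring
    have hx0 : 0 ≤ x := by
      rw [hx]; have := sub_nonneg.2 h1; positivity
    have hx1 : x ≤ K + 1 := by
      rw [hx, div_le_iff₀ hb]; gcongr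
    have hj : (gridIndex a b K z i : ℕ) = min K ⌊x⌋₊ := by rw [hx]; rfl
    rw [hj, hz]
    have hlow : ((min K ⌊x⌋₊ : ℕ) : ℝ) ≤ x :=
      (Nat.cast_le.2 (min_le_right _ _)).trans (Nat.floor_le hx0)
    have hup : x ≤ ((min K ⌊x⌋₊ : ℕ) : ℝ) + 1 := by
      rcases min_choice K ⌊x⌋₊ with h' | h' <;> rw [h']
      · exact hx1
      · exact (Nat.lt_floor_add_one x).le
    constructor <;> gcongr
  exact ⟨fun i => (key i).1, fun i => (key i).2⟩

theorem setIntegral_gridCell_le {d : ℕ} {a b : Fin d → ℝ} (hab : a ≤ b) {g : (Fin d → ℝ) → ℝ}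
    {S Λ : ℝ} (hg : ∀ z, 0 ≤ g z) (hS0 : 0 ≤ S) (hS : ∀ z ∈ Set.Icc a b, g z ≤ S)
    (hΛ : S * ∏ i, (b i - a i) ≤ Λ) (K : ℕ) (q : Fin d → Fin (K + 1)) :
    ∫ z in Set.Icc a b ∩ gridIndex a b K ⁻¹' {q}, g z ≤ Λ / ((K + 1) ^ d : ℕ) := by
  set A := Set.Icc a b ∩ gridIndex a b K ⁻¹' {q} with hA
  have hsub := Icc_inter_gridIndex_preimage_subset (a := a) (b := b) K q
  have hvol : volume A ≤ ENNReal.ofReal (∏ i, (b i - a i) / (K + 1)) := by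
    refine (measure_mono hsub).trans (le_of_eq ?_)
    rw [Real.volume_Icc_pi, ENNReal.ofReal_prod_of_nonneg]
    · refine Finset.prod_congr rfl fun i _ => ?_
      congr 1
      ring
    · intro i _
      have := sub_nonneg.2 (hab i)
      positivity
  have hfin : volume A < ⊤ := hvol.trans_lt ENNReal.ofReal_lt_top
  have hnn : 0 ≤ ∏ i, (b i - a i) / ((K : ℝ) + 1) := Finset.prod_nonneg fun i _ => by
    have := sub_nonneg.2 (hab i)
    positivity
  have h1 := norm_setIntegral_le_of_norm_le_const (μ := volume) (f := g) (C := S) hfin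
    (fun z hz => by rw [Real.norm_of_nonneg (hg z)]; exact hS z hz.1)
  calc ∫ z in A, g z ≤ S * volume.real A := (Real.le_norm_self _).trans h1
    _ ≤ S * ∏ i, (b i - a i) / ((K : ℝ) + 1) := by
        gcongr
        exact ENNReal.toReal_le_of_le_ofReal hnn hvol
    _ = S * (∏ i, (b i - a i)) / ((K + 1) ^ d : ℕ) := by
        rw [Finset.prod_div_distrib]
        simp [mul_div_assoc]
    _ ≤ _ := by gcongr

theorem summable_pow_div_factorial_mul {x C : ℝ} (hx : 0 ≤ x) {u : ℕ → ℝ} (h0 : ∀ k, 0 ≤ u k)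
    (hu : ∀ k, u k ≤ C ^ k) : Summable fun k => x ^ k / k.factorial * u k := by
  refine Summable.of_nonneg_of_le (fun k => mul_nonneg (by positivity) (h0 k)) (fun k => ?_)
    (Real.summable_pow_div_factorial (x * C))
  calc x ^ k / k.factorial * u k ≤ x ^ k / k.factorial * C ^ k := by gcongr; exact hu k
    _ = (x * C) ^ k / k.factorial := by rw [mul_pow]; ring

open Classical BigOperators in
theorem PoissonPP.measure_le_chainLength_Icc_le_grid {d : ℕ} {Ω : Type*} [MeasurableSpace Ω]
    {P : Measure Ω} [IsProbabilityMeasure P] {g : (Fin d → ℝ) → ℝ} (X : PoissonPP d P g)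
    {a b : Fin d → ℝ} (hab : a ≤ b)
    {S Λ t : ℝ} (hg : ∀ z, 0 ≤ g z) (hS0 : 0 ≤ S) (hS : ∀ z ∈ Set.Icc a b, g z ≤ S)
    (hΛ : S * ∏ i, (b i - a i) ≤ Λ) (hΛ0 : 0 ≤ Λ) (ht : 1 ≤ t) (m K : ℕ) :
    P {ω | m ≤ chainLength d (X.pts ω ∩ Set.Icc a b)} ≤ ENNReal.ofReal
      (Λ ^ 2 / ((K + 1) ^ d : ℕ) + ((1 + Λ / ((K + 1) ^ d : ℕ)) ^ ((K + 1) ^ d))⁻¹ *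
        ((t ^ m)⁻¹ * ∑' k : ℕ, Λ ^ k / k.factorial *
          Real.exp ((t - 1) * min (k : ℝ) (BWexpect d k + k ^ 3 * d / (K + 1))))) := by
  set N : ℕ := (K + 1) ^ d with hN
  have hN0 : (0 : ℝ) < N := by positivity
  have hcard : Fintype.card (Fin d → Fin (K + 1)) = N := by simp [hN]
  set lam : ℝ := Λ / N with hlam
  have hlam0 : 0 ≤ lam := by positivity
  have h := X.measure_le_chainLength_le (R := Set.Icc a b) (φ := gridIndex a b K)
    (Metric.isBounded_Icc a b) ((gridIndex_monotone hab K).monotoneOn _)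
    (fun q => measurableSet_Icc.inter (measurableSet_gridIndex_preimage a b K q))
    hlam0 (fun q => integral_nonneg fun z => hg z)
    (fun q => setIntegral_gridCell_le hab hg hS0 hS hΛ K q) m
  refine h.trans (ENNReal.ofReal_le_ofReal ?_)
  rw [hcard]
  have hNl : (N : ℝ) * lam = Λ := by rw [hlam]; field_simp
  refine add_le_add (le_of_eq (by rw [hlam]; field_simp)) ?_
  have h2 := sum_pow_card_le (Q := Fin d → Fin (K + 1)) hlam0 ht m
  simp only [hcard, hNl] at h2
  calc _ = ((1 + lam) ^ N)⁻¹ * ∑ T : Finset (Fin d → Fin (K + 1)),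
          (if m ≤ maxChainCard T then (1 : ℝ) else 0) * lam ^ T.card := by
        rw [Finset.mul_sum]
        exact Finset.sum_congr rfl fun T _ => by rw [div_eq_mul_inv]; ring
    _ ≤ _ := by
        refine mul_le_mul_of_nonneg_left (h2.trans ?_) (by positivity)
        refine mul_le_mul_of_nonneg_left ?_ (by positivity)
        refine le_trans (Finset.sum_le_sum fun k _ => ?_)
          (Summable.sum_le_tsum _ (fun k _ => by positivity)
          (summable_pow_div_factorial_mul (C := Real.exp (t - 1)) hΛ0
            (fun k => (Real.exp_pos _).le) fun k => ?_))
        · refine mul_le_mul_of_nonneg_left (Real.exp_le_exp.2 ?_) (by positivity)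
          refine mul_le_mul_of_nonneg_left (le_min ?_ ?_) (by linarith)
          · refine Finset.expect_le Finset.univ_nonempty fun q _ => ?_
            exact_mod_cast tupleChain_le q
          · exact expect_tupleChain_le_BWexpect d k K
        · rw [← Real.exp_nat_mul, mul_comm]
          exact Real.exp_le_exp.2 (mul_le_mul_of_nonneg_right (min_le_left _ _) (by linarith))

theorem PoissonPP.measure_le_chainLength_Icc_le {d : ℕ} (hd : 0 < d) {Ω : Type*}
    [MeasurableSpace Ω]
    {P : Measure Ω} [IsProbabilityMeasure P] {g : (Fin d → ℝ) → ℝ} (X : PoissonPP d P g)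
    {a b : Fin d → ℝ} (hab : a ≤ b)
    {S Λ t : ℝ} (hg : ∀ z, 0 ≤ g z) (hS0 : 0 ≤ S) (hS : ∀ z ∈ Set.Icc a b, g z ≤ S)
    (hΛ : S * ∏ i, (b i - a i) ≤ Λ) (hΛ0 : 0 ≤ Λ) (ht : 1 ≤ t) (m : ℕ) :
    P {ω | m ≤ chainLength d (X.pts ω ∩ Set.Icc a b)} ≤ ENNReal.ofReal
      ((Real.exp Λ)⁻¹ * ((t ^ m)⁻¹ * ∑' k : ℕ, Λ ^ k / k.factorial *
          Real.exp ((t - 1) * min (k : ℝ) (BWexpect d k)))) := by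
  have hNat : Tendsto (fun K : ℕ => (K + 1) ^ d) atTop atTop :=
    (tendsto_pow_atTop hd.ne').comp (tendsto_add_atTop_nat 1)
  have hN : Tendsto (fun K : ℕ => (((K + 1) ^ d : ℕ) : ℝ)) atTop atTop :=
    tendsto_natCast_atTop_atTop.comp hNat
  have h1 : Tendsto (fun K : ℕ => Λ ^ 2 / ((K + 1) ^ d : ℕ)) atTop (𝓝 0) :=
    tendsto_const_nhds.div_atTop hN
  have h2 : Tendsto (fun K : ℕ => ((1 + Λ / ((K + 1) ^ d : ℕ)) ^ ((K + 1) ^ d))⁻¹) atTop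
      (𝓝 (Real.exp Λ)⁻¹) :=
    ((Real.tendsto_one_add_div_pow_exp Λ).comp hNat).inv₀ (Real.exp_pos _).ne'
  have h3 : Tendsto (fun K : ℕ => ∑' k : ℕ, Λ ^ k / k.factorial *
      Real.exp ((t - 1) * min (k : ℝ) (BWexpect d k + k ^ 3 * d / (K + 1)))) atTop
      (𝓝 (∑' k : ℕ, Λ ^ k / k.factorial * Real.exp ((t - 1) * min (k : ℝ) (BWexpect d k)))) := by
    refine tendsto_tsum_of_dominated_convergence
      (bound := fun k => Λ ^ k / k.factorial * Real.exp (t - 1) ^ k)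
      (summable_pow_div_factorial_mul (C := Real.exp (t - 1)) hΛ0 (fun k => by positivity)
        fun k => le_rfl) (fun k => ?_) (Eventually.of_forall fun K k => ?_)
    · have hk : Tendsto (fun K : ℕ => (k : ℝ) ^ 3 * d / ((K : ℝ) + 1)) atTop (𝓝 0) :=
        tendsto_const_nhds.div_atTop
          (tendsto_atTop_add_const_right _ _ tendsto_natCast_atTop_atTop)
      have hk' := (tendsto_const_nhds (x := (k : ℝ))).min (hk.const_add (BWexpect d k))
      rw [add_zero] at hk'
      exact ((Real.continuous_exp.tendsto _).comp (hk'.const_mul (t - 1))).const_mul _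
    · rw [Real.norm_of_nonneg (by positivity), ← Real.exp_nat_mul, mul_comm (k : ℝ)]
      refine mul_le_mul_of_nonneg_left (Real.exp_le_exp.2 ?_) (by positivity)
      exact mul_le_mul_of_nonneg_left (min_le_left _ _) (by linarith)
  have h4 := h1.add (h2.mul (h3.const_mul (t ^ m)⁻¹))
  rw [zero_add] at h4
  exact ge_of_tendsto' (ENNReal.tendsto_ofReal h4) fun K =>
    X.measure_le_chainLength_Icc_le_grid hab hg hS0 hS hΛ hΛ0 ht m K

theorem IsBWConstant.exists_BWexpect_le {d : ℕ} {c c' : ℝ} (hc : IsBWConstant d c)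
    (hcc' : c < c') : ∃ C, 0 ≤ C ∧ ∀ k : ℕ, BWexpect d k ≤ C + c' * (k : ℝ) ^ (1 / d : ℝ) := by
  have hc'0 : 0 ≤ c' := (hc.1.trans hcc').le
  obtain ⟨k₀, hk₀⟩ := eventually_atTop.1 (hc.2.eventually (gt_mem_nhds hcc'))
  refine ⟨∑ j ∈ Finset.range (k₀ + 1), |BWexpect d j|,
    Finset.sum_nonneg fun j _ => abs_nonneg _, fun k => ?_⟩
  rcases le_or_gt k k₀ with hk | hk
  · calc BWexpect d k ≤ |BWexpect d k| := le_abs_self _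
      _ ≤ ∑ j ∈ Finset.range (k₀ + 1), |BWexpect d j| :=
        Finset.single_le_sum (f := fun j => |BWexpect d j|) (fun j _ => abs_nonneg _)
          (Finset.mem_range.2 (Nat.lt_succ_of_le hk))
      _ ≤ _ := le_add_of_nonneg_right (by positivity)
  · have h := (hk₀ k hk.le).le
    have hkpos : (0 : ℝ) < k := by exact_mod_cast (Nat.zero_le _).trans_lt hk
    rw [neg_div, Real.rpow_neg hkpos.le, inv_mul_le_iff₀ (by positivity)] at h
    have : 0 ≤ ∑ j ∈ Finset.range (k₀ + 1), |BWexpect d j| :=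
      Finset.sum_nonneg fun j _ => abs_nonneg _
    linarith

theorem rpow_le_tangent {p x y : ℝ} (hp0 : 0 ≤ p) (hp1 : p ≤ 1) (hx : 0 ≤ x) (hy : 0 < y) :
    x ^ p ≤ (1 - p) * y ^ p + p * (y ^ p / y) * x := by
  have h := Real.geom_mean_le_arith_mean2_weighted (sub_nonneg.2 hp1) hp0 zero_le_one
    (div_nonneg hx hy.le) (sub_add_cancel 1 p)
  rw [Real.one_rpow, one_mul, mul_one, Real.div_rpow hx hy.le, div_le_iff₀ (by positivity)] at h
  calc x ^ p ≤ _ := h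
    _ = _ := by ring

theorem tsum_pow_div_factorial_mul_exp_le {Λ A s : ℝ} (hΛ : 0 ≤ Λ) {u : ℕ → ℝ}
    (hu : ∀ k, u k ≤ A + s * k) :
    ∑' k : ℕ, Λ ^ k / k.factorial * Real.exp (u k) ≤ Real.exp (A + Λ * Real.exp s) := by
  have hs : HasSum (fun k : ℕ => Real.exp A * ((Λ * Real.exp s) ^ k / k.factorial))
      (Real.exp A * Real.exp (Λ * Real.exp s)) := by
    refine HasSum.mul_left _ ?_
    rw [Real.exp_eq_exp_ℝ]
    exact NormedSpace.expSeries_div_hasSum_exp _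
  have hle : ∀ k : ℕ, Λ ^ k / k.factorial * Real.exp (u k) ≤
      Real.exp A * ((Λ * Real.exp s) ^ k / k.factorial) := fun k => by
    calc Λ ^ k / k.factorial * Real.exp (u k)
        ≤ Λ ^ k / k.factorial * Real.exp (A + s * k) := by gcongr; exact hu k
      _ = _ := by rw [Real.exp_add, mul_comm s, Real.exp_nat_mul, mul_pow]; ring
  rw [Real.exp_add, ← hs.tsum_eq]
  exact Summable.tsum_le_tsum hle
    (Summable.of_nonneg_of_le (fun k => by positivity) hle hs.summable) hs.summable

theorem exp_mul_le_one_add_pow {τ x : ℝ} (hτ : 0 ≤ τ) {m : ℕ} (hx : x ≤ m) (hx0 : 0 ≤ x) :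
    Real.exp ((τ - τ ^ 2) * x) ≤ (1 + τ) ^ m := by
  have h1 : Real.exp (τ - τ ^ 2) ≤ 1 + τ := by
    rw [← Real.le_log_iff_exp_le (by linarith)]
    have h := Real.one_sub_inv_le_log_of_pos (show 0 < 1 + τ by linarith)
    refine le_trans ?_ h
    have : 1 - (1 + τ)⁻¹ = τ / (1 + τ) := by field_simp; ring
    rw [this, le_div_iff₀ (by linarith)]
    nlinarith [pow_nonneg hτ 3]
  calc Real.exp ((τ - τ ^ 2) * x) = Real.exp (τ - τ ^ 2) ^ x := by rw [Real.exp_mul]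
    _ ≤ (1 + τ) ^ x := Real.rpow_le_rpow (Real.exp_pos _).le h1 hx0
    _ ≤ (1 + τ) ^ (m : ℝ) := Real.rpow_le_rpow_of_exponent_le (by linarith) hx
    _ = (1 + τ) ^ m := Real.rpow_natCast _ _

theorem IsBWConstant.exists_exp_bound {d : ℕ} (hd : 0 < d) {c ε : ℝ} (hc : IsBWConstant d c)
    (hε : 0 < ε) : ∃ t C α : ℝ, 1 ≤ t ∧ 0 < α ∧ ∀ Λ : ℝ, 1 ≤ Λ → ∀ m : ℕ,
      (c + ε) * Λ ^ (1 / d : ℝ) ≤ m →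
      (Real.exp Λ)⁻¹ * ((t ^ m)⁻¹ * ∑' k : ℕ, Λ ^ k / k.factorial *
          Real.exp ((t - 1) * min (k : ℝ) (BWexpect d k))) ≤
        Real.exp (C - α * Λ ^ (1 / d : ℝ)) := by
  have hc0 := hc.1
  set c' := c + ε / 2 with hc'
  obtain ⟨C, hC0, hC⟩ := hc.exists_BWexpect_le (c' := c') (by linarith)
  have hc'0 : 0 < c' := by positivity
  set B := c + ε + c' ^ 2 + c' + 1 with hB
  have hB0 : 0 < B := by positivity
  set τ := min 1 (ε / 4) / B with hτ
  have hτ0 : 0 < τ := by positivity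
  have hτB : τ * B = min 1 (ε / 4) := by rw [hτ]; field_simp
  have hτ1 : τ * B ≤ 1 := hτB.trans_le (min_le_left _ _)
  have hτ2 : τ * B ≤ ε / 4 := hτB.trans_le (min_le_right _ _)
  have hp0 : (0 : ℝ) ≤ 1 / d := by positivity
  have hp1 : (1 / d : ℝ) ≤ 1 := by
    rw [div_le_one (by exact_mod_cast hd)]
    exact_mod_cast hd
  refine ⟨1 + τ, τ * C, τ * (ε / 4), by linarith, by positivity, fun Λ hΛ m hm => ?_⟩
  have hΛ0 : 0 < Λ := by linarith
  have htan := fun k : ℕ => rpow_le_tangent hp0 hp1 (Nat.cast_nonneg k) hΛ0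
  generalize hp : (1 / d : ℝ) = p at *
  have hLΛ : Λ ^ p ≤ Λ := by
    simpa using Real.rpow_le_rpow_of_exponent_le hΛ hp1
  have hL0 : 0 < Λ ^ p := by positivity
  generalize hL : Λ ^ p = L at *
  set s := τ * c' * p * (L / Λ) with hs
  have hr0 : 0 ≤ L / Λ := by positivity
  have hr1 : L / Λ ≤ 1 := (div_le_one hΛ0).2 hLΛ
  have hpr0 : 0 ≤ p * (L / Λ) := by positivity
  have hpr1 : p * (L / Λ) ≤ 1 := mul_le_one₀ hp1 hr0 hr1
  have hτc : τ * c' ≤ 1 := by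
    refine le_trans ?_ hτ1
    gcongr
    rw [hB]; nlinarith
  have hs0 : 0 ≤ s := by positivity
  have hs1 : s ≤ 1 := by
    rw [hs, mul_assoc (τ * c')]
    exact mul_le_one₀ hτc hpr0 hpr1
  have hsum := tsum_pow_div_factorial_mul_exp_le (Λ := Λ) (A := τ * (C + c' * (1 - p) * L))
    (s := s) (u := fun k => (1 + τ - 1) * min (k : ℝ) (BWexpect d k)) hΛ0.le (fun k => by
      calc (1 + τ - 1) * min (k : ℝ) (BWexpect d k)
          ≤ τ * (C + c' * ((1 - p) * L + p * (L / Λ) * k)) := by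
            rw [add_sub_cancel_left]
            gcongr
            refine (min_le_right _ _).trans ((hC k).trans ?_)
            gcongr
            exact htan k
        _ = _ := by rw [hs]; ring)
  have hexp : Λ * (Real.exp s - 1) ≤ τ * c' * p * L + τ ^ 2 * c' ^ 2 * L := by
    have h1 := Real.abs_exp_sub_one_sub_id_le (abs_le.2 ⟨by linarith, hs1⟩)
    have h2 := (le_abs_self _).trans h1
    have h3 : Λ * s = τ * c' * p * L := by rw [hs]; field_simp
    have h4 : s ≤ τ * c' := by
      rw [hs, mul_assoc (τ * c')]
      exact mul_le_of_le_one_right (by positivity) hpr1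
    have h5 : Λ * s ^ 2 ≤ τ ^ 2 * c' ^ 2 * L := by
      calc Λ * s ^ 2 = (Λ * s) * s := by ring
        _ ≤ (τ * c' * p * L) * (τ * c') := by rw [h3]; gcongr
        _ = (τ ^ 2 * c' ^ 2 * L) * p := by ring
        _ ≤ _ := mul_le_of_le_one_right (by positivity) hp1
    nlinarith
  have hpow := exp_mul_le_one_add_pow hτ0.le hm (by positivity)
  calc _ ≤ (Real.exp Λ)⁻¹ * ((Real.exp ((τ - τ ^ 2) * ((c + ε) * L)))⁻¹ *
          Real.exp (τ * (C + c' * (1 - p) * L) + Λ * Real.exp s)) := by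
        gcongr
    _ = Real.exp (-Λ - (τ - τ ^ 2) * ((c + ε) * L) +
          (τ * (C + c' * (1 - p) * L) + Λ * Real.exp s)) := by
        rw [← Real.exp_neg, ← Real.exp_neg, ← Real.exp_add, ← Real.exp_add]
        congr 1
        ring
    _ ≤ _ := by
        refine Real.exp_le_exp.2 ?_
        have h6 : τ * L * (τ * (c + ε + c' ^ 2)) ≤ τ * L * (ε / 4) := by
          gcongr
          refine le_trans ?_ hτ2
          gcongr
          rw [hB]; linarith
        have h7 : τ * c' * L = τ * c * L + τ * L * (ε / 2) := by rw [hc']; ring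
        nlinarith

theorem summable_exp_sub_mul_rpow {p C α V : ℝ} (hp : 0 < p) (hα : 0 < α) (hV : 0 < V) :
    Summable fun n : ℕ => Real.exp (C - α * ((n : ℝ) * V) ^ p) := by
  have hlim : Tendsto (fun n : ℕ => ((n : ℝ) * V) ^ p) atTop atTop :=
    (tendsto_rpow_atTop hp).comp (tendsto_natCast_atTop_atTop.atTop_mul_const hV)
  have ho := (isLittleO_exp_neg_mul_rpow_atTop hα (-(2 / p))).comp_tendsto hlim
  have hs : Summable fun n : ℕ => Real.exp (-α * ((n : ℝ) * V) ^ p) := by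
    refine summable_of_isBigO_nat
      ((Real.summable_nat_rpow.2 (show (-2 : ℝ) < -1 by norm_num)).mul_right (V ^ (-2 : ℝ)))
      (ho.isBigO.congr_right fun n => ?_)
    simp only [Function.comp_apply]
    rw [← Real.rpow_mul (by positivity), ← Real.mul_rpow (by positivity) hV.le]
    congr 1
    field_simp
  refine (hs.mul_left (Real.exp C)).congr fun n => ?_
  rw [← Real.exp_add]
  congr 1
  ring

theorem ae_eventually_chainLength_Icc_le {d : ℕ} (hd : 0 < d) {c ε : ℝ} (hc : IsBWConstant d c)
    (hε : 0 < ε) {f : (Fin d → ℝ) → ℝ} (hf : ∀ z, 0 ≤ f z)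
    {Ω : Type*} [MeasurableSpace Ω] {P : Measure Ω} [IsProbabilityMeasure P]
    (PP : ∀ n : ℕ, PoissonPP d P fun z => (n : ℝ) * f z)
    {a b : Fin d → ℝ} (hab : a ≤ b) {S V : ℝ} (hS0 : 0 ≤ S) (hS : ∀ z ∈ Set.Icc a b, f z ≤ S)
    (hV0 : 0 < V) (hV : S * ∏ i, (b i - a i) ≤ V) :
    ∀ᵐ ω ∂P, ∀ᶠ n : ℕ in atTop,
      (chainLength d ((PP n).pts ω ∩ Set.Icc a b) : ℝ) ≤ (c + ε) * ((n : ℝ) * V) ^ (1 / d : ℝ) := by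
  obtain ⟨t, C, α, ht, hα, hbound⟩ := hc.exists_exp_bound hd hε
  set m : ℕ → ℕ := fun n => ⌈(c + ε) * ((n : ℝ) * V) ^ (1 / d : ℝ)⌉₊ with hm
  set s : ℕ → Set Ω := fun n =>
    {ω | 1 ≤ (n : ℝ) * V ∧ m n ≤ chainLength d ((PP n).pts ω ∩ Set.Icc a b)} with hs
  have hd' : (0 : ℝ) < 1 / d := by positivity
  have hle : ∀ n, P (s n) ≤ ENNReal.ofReal (Real.exp (C - α * ((n : ℝ) * V) ^ (1 / d : ℝ))) := by
    intro n
    by_cases h1 : 1 ≤ (n : ℝ) * V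
    · refine (measure_mono fun ω hω => hω.2).trans
        (((PP n).measure_le_chainLength_Icc_le hd hab (S := n * S) (Λ := n * V)
          (fun z => mul_nonneg (Nat.cast_nonneg n) (hf z)) (by positivity)
          (fun z hz => mul_le_mul_of_nonneg_left (hS z hz) (Nat.cast_nonneg n)) ?_
          (by positivity) ht (m n)).trans
          (ENNReal.ofReal_le_ofReal (hbound _ h1 _ (Nat.le_ceil _))))
      rw [mul_assoc]
      exact mul_le_mul_of_nonneg_left hV (Nat.cast_nonneg n)
    · simp [hs, h1]
  have hsum : ∑' n, P (s n) ≠ ⊤ := by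
    refine ne_top_of_le_ne_top ?_ (ENNReal.tsum_le_tsum hle)
    exact (summable_exp_sub_mul_rpow hd' hα hV0).tsum_ofReal_ne_top
  have hlarge : ∀ᶠ n : ℕ in atTop, 1 ≤ (n : ℝ) * V :=
    (tendsto_natCast_atTop_atTop.atTop_mul_const hV0).eventually_ge_atTop 1
  filter_upwards [ae_eventually_notMem hsum] with ω hω
  filter_upwards [hω, hlarge] with n hn h1
  have hn' : chainLength d ((PP n).pts ω ∩ Set.Icc a b) < m n := by
    by_contra h
    exact hn ⟨h1, not_lt.1 h⟩
  exact (Nat.lt_ceil.1 hn').le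

theorem PoissonPP.ae_finite_inter {d : ℕ} {Ω : Type*} [MeasurableSpace Ω] {P : Measure Ω}
    [IsProbabilityMeasure P] {g : (Fin d → ℝ) → ℝ} (X : PoissonPP d P g) (hg : ∀ z, 0 ≤ g z)
    {A : Set (Fin d → ℝ)} (hA : MeasurableSet A) (hb : Bornology.IsBounded A) :
    ∀ᵐ ω ∂P, (X.pts ω ∩ A).Finite := by
  set Λ := ∫ z in A, g z with hΛ
  have hΛ0 : 0 ≤ Λ := integral_nonneg fun z => hg z
  have hmeas := X.measur A hA hb
  have hsum : HasSum (fun k : ℕ => Real.exp (-Λ) * Λ ^ k / k.factorial) 1 := by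
    have h := (NormedSpace.expSeries_div_hasSum_exp (𝔸 := ℝ) Λ).mul_left (Real.exp (-Λ))
    rw [← Real.exp_eq_exp_ℝ, ← Real.exp_add, neg_add_cancel, Real.exp_zero] at h
    exact h.congr_fun fun k => mul_div_assoc _ _ _
  have hP : P (⋃ k : ℕ, {ω | (X.pts ω ∩ A).encard = k}) = 1 := by
    rw [measure_iUnion (fun k l hkl => Set.disjoint_left.2 fun ω hk hl => hkl ?_) hmeas]
    · simp_rw [X.poisson A hA hb, ← hΛ]
      rw [← ENNReal.ofReal_tsum_of_nonneg (fun k => by positivity) hsum.summable, hsum.tsum_eq,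
        ENNReal.ofReal_one]
    · exact_mod_cast (show (k : ℕ∞) = l from hk.symm.trans hl)
  have hae := (prob_compl_eq_zero_iff (MeasurableSet.iUnion hmeas)).2 hP
  filter_upwards [compl_mem_ae_iff.2 hae] with ω hω
  rw [compl_compl, Set.mem_iUnion] at hω
  obtain ⟨k, hk⟩ := hω
  exact Set.finite_of_encard_eq_coe hk

/-- The part of `[0, M]^d` where the `i`-th coordinate lies between `y i` and `max (x i) (y i)`. -/
def slab {d : ℕ} (M : ℝ) (x y : Fin d → ℝ) (i : Fin d) : Set (Fin d → ℝ) :=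
  Set.Icc (Function.update 0 i (y i)) (Function.update (fun _ => M) i (max (x i) (y i)))

theorem slab_subset {d : ℕ} {M : ℝ} {x y : Fin d → ℝ} (hy : 0 ≤ y)
    (hM : ∀ i, max (x i) (y i) ≤ M) (i : Fin d) : slab M x y i ⊆ Set.Icc 0 fun _ => M := by
  refine Set.Icc_subset_Icc ?_ ?_
  · exact le_update_iff.2 ⟨hy i, fun _ _ => le_rfl⟩
  · exact update_le_iff.2 ⟨hM i, fun _ _ => le_rfl⟩

open Classical in
theorem chainLength_inter_Icc_le {d : ℕ} {M : ℝ} {x y : Fin d → ℝ} (hy : 0 ≤ y)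
    (hM : ∀ i, max (x i) (y i) ≤ M) {A : Set (Fin d → ℝ)}
    (hA : (A ∩ Set.Icc 0 fun _ => M).Finite) :
    chainLength d (A ∩ Set.Icc 0 x) ≤
      chainLength d (A ∩ Set.Icc 0 y) + ∑ i, chainLength d (A ∩ slab M x y i) := by
  obtain ⟨C, hC, hchain, hcard⟩ := exists_isChain_of_le_chainLength
    (le_refl (chainLength d (A ∩ Set.Icc 0 x)))
  have hsub : C ⊆ C.filter (· ∈ Set.Icc 0 y) ∪
      Finset.univ.biUnion fun i => C.filter (· ∈ slab M x y i) := by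
    intro z hz
    obtain ⟨hzA, hz0, hzx⟩ := hC hz
    simp only [Finset.mem_union, Finset.mem_filter, Finset.mem_biUnion, Finset.mem_univ, true_and]
    by_cases h : z ≤ y
    · exact Or.inl ⟨hz, hz0, h⟩
    · obtain ⟨i, hi⟩ : ∃ i, ¬ z i ≤ y i := by simpa [Pi.le_def] using h
      refine Or.inr ⟨i, hz, ?_, ?_⟩
      · exact update_le_iff.2 ⟨(not_le.1 hi).le, fun j _ => hz0 j⟩
      · exact le_update_iff.2 ⟨(hzx i).trans (le_max_left _ _),
          fun j _ => (hzx j).trans ((le_max_left _ _).trans (hM j))⟩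
  have hpart : ∀ R ⊆ Set.Icc 0 fun _ => M, ∀ [DecidablePred (· ∈ R)],
      (C.filter (· ∈ R)).card ≤ chainLength d (A ∩ R) := by
    intro R hR _
    refine card_le_chainLength (hA.subset (Set.inter_subset_inter_right A hR)) (fun z hz => ?_)
      (hchain.mono fun z hz => (Finset.mem_filter.1 hz).1)
    obtain ⟨hzC, hzR⟩ := Finset.mem_filter.1 hz
    exact ⟨(hC hzC).1, hzR⟩
  calc chainLength d (A ∩ Set.Icc 0 x) ≤ C.card := by omega
    _ ≤ _ := Finset.card_le_card hsub
    _ ≤ (C.filter (· ∈ Set.Icc 0 y)).card + ∑ i, (C.filter (· ∈ slab M x y i)).card :=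
        (Finset.card_union_le _ _).trans (Nat.add_le_add_left Finset.card_biUnion_le _)
    _ ≤ _ := by
        gcongr with i
        · exact hpart _ (Set.Icc_subset_Icc_right fun i => (le_max_right _ _).trans (hM i))
        · exact hpart _ (slab_subset hy hM i)

theorem prod_update_sub_update_le {d : ℕ} {M : ℝ} (hM0 : 0 ≤ M) (x y : Fin d → ℝ) (i : Fin d) :
    ∏ j, (Function.update (fun _ => M) i (max (x i) (y i)) j -
      Function.update (0 : Fin d → ℝ) i (y i) j) ≤ M ^ (d - 1) * euclNorm d (x - y) := by
  have hE : max (x i) (y i) - y i ≤ euclNorm d (x - y) := by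
    have h1 : |x i - y i| ≤ euclNorm d (x - y) := by
      rw [euclNorm, ← Real.sqrt_sq_eq_abs]
      exact Real.sqrt_le_sqrt
        (Finset.single_le_sum (f := fun j => ((x - y) j) ^ 2) (fun j _ => sq_nonneg _)
          (Finset.mem_univ i))
    refine le_trans ?_ h1
    rw [sub_le_iff_le_add]
    exact max_le (by linarith [le_abs_self (x i - y i)]) (by linarith [abs_nonneg (x i - y i)])
  rw [← Finset.mul_prod_erase _ _ (Finset.mem_univ i), mul_comm]
  simp only [Function.update_self]
  rw [Finset.prod_congr rfl (g := fun _ => M) fun j hj => by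
    simp [Function.update_of_ne (Finset.ne_of_mem_erase hj)]]
  simp only [Finset.prod_const, Finset.card_erase_of_mem (Finset.mem_univ i), Finset.card_univ,
    Fintype.card_fin]
  gcongr

theorem MemB.bddAbove_image {d : ℕ} {f : (Fin d → ℝ) → ℝ} (hf : MemB d f)
    {K : Set (Fin d → ℝ)} (hK : IsCompact K) : BddAbove (f '' K) := by
  refine hK.induction_on (p := fun s => BddAbove (f '' s)) (by simp)
    (fun s t hst ht => ht.mono (Set.image_mono hst))
    (fun s t hs ht => by rw [Set.image_union]; exact hs.union ht) fun z _ => ?_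
  obtain ⟨U, hU, hb⟩ := hf.2.2 z
  exact ⟨U, mem_nhdsWithin_of_mem_nhds hU, hb⟩

theorem limsup_le_of_eventually_le_of_nonneg {u : ℕ → ℝ} {a : ℝ} (ha : 0 ≤ a)
    (h : ∀ᶠ n in atTop, u n ≤ a) : limsup u atTop ≤ a := by
  rw [limsup_eq]
  by_cases hb : BddBelow {a | ∀ᶠ n in atTop, u n ≤ a}
  · exact csInf_le hb h
  · rwa [Real.sInf_of_not_bddBelow hb]

theorem ae_eventually_chainLength_sub_le {d : ℕ} (hd : 0 < d) {c η : ℝ} (hc : IsBWConstant d c)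
    (hη : 0 < η) {f : (Fin d → ℝ) → ℝ} (hf : MemB d f)
    {Ω : Type*} [MeasurableSpace Ω] {P : Measure Ω} [IsProbabilityMeasure P]
    (PP : ∀ n : ℕ, PoissonPP d P fun z => (n : ℝ) * f z)
    {M S : ℝ} {x y : Fin d → ℝ} (hy : 0 ≤ y) (hM : ∀ i, max (x i) (y i) ≤ M)
    (hS : ∀ z ∈ Set.Icc (0 : Fin d → ℝ) (fun _ => M), f z ≤ S) (hS0 : 0 ≤ S) (hM0 : 0 ≤ M) :
    ∀ᵐ ω ∂P, ∀ᶠ n : ℕ in atTop, (n : ℝ) ^ (-(1 : ℝ) / d) *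
          ((chainLength d ((PP n).pts ω ∩ Set.Icc 0 x) : ℝ) -
            (chainLength d ((PP n).pts ω ∩ Set.Icc 0 y) : ℝ)) ≤
      d * ((c + η) * (S * (M ^ (d - 1) * euclNorm d (x - y)) + η) ^ (1 / d : ℝ)) := by
  set V := S * (M ^ (d - 1) * euclNorm d (x - y)) + η with hV
  have hV0 : 0 < V := by
    have : 0 ≤ euclNorm d (x - y) := Real.sqrt_nonneg _
    positivity
  have hfin : ∀ᵐ ω ∂P, ∀ n, ((PP n).pts ω ∩ Set.Icc 0 fun _ => M).Finite :=
    ae_all_iff.2 fun n => (PP n).ae_finite_inter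
      (fun z => mul_nonneg (Nat.cast_nonneg n) (hf.2.1 z)) measurableSet_Icc
      (Metric.isBounded_Icc _ _)
  have hslab : ∀ᵐ ω ∂P, ∀ i, ∀ᶠ n : ℕ in atTop,
      (chainLength d ((PP n).pts ω ∩ slab M x y i) : ℝ) ≤
        (c + η) * ((n : ℝ) * V) ^ (1 / d : ℝ) := by
    refine ae_all_iff.2 fun i => ae_eventually_chainLength_Icc_le hd hc hη hf.2.1 PP ?_ hS0
      (fun z hz => hS z (slab_subset hy hM i hz)) hV0 ?_
    · refine update_le_iff.2 ⟨by simp, fun j hj => ?_⟩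
      simpa [Function.update_of_ne hj] using hM0
    · have := mul_le_mul_of_nonneg_left (prod_update_sub_update_le hM0 x y i) hS0
      linarith
  filter_upwards [hfin, hslab] with ω hω hω'
  filter_upwards [eventually_all.2 hω', eventually_gt_atTop 0] with n hn hn0
  have hn0' : (0 : ℝ) < n := by exact_mod_cast hn0
  have h1 : (chainLength d ((PP n).pts ω ∩ Set.Icc 0 x) : ℝ) ≤
      chainLength d ((PP n).pts ω ∩ Set.Icc 0 y) +
        ∑ i, (chainLength d ((PP n).pts ω ∩ slab M x y i) : ℝ) := by
    exact_mod_cast chainLength_inter_Icc_le hy hM (hω n)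
  have h2 : ∑ i, (chainLength d ((PP n).pts ω ∩ slab M x y i) : ℝ) ≤
      d * ((c + η) * ((n : ℝ) * V) ^ (1 / d : ℝ)) := by
    refine (Finset.sum_le_sum fun i _ => hn i).trans (le_of_eq ?_)
    simp
  rw [neg_div, Real.rpow_neg hn0'.le, inv_mul_le_iff₀ (by positivity)]
  rw [Real.mul_rpow hn0'.le hV0.le] at h2
  linarith

/-- For fixed `x, y ∈ [0,∞)^d`, with probability one,
`limsup_n n^{-1/d} (U_n(x) - U_n(y)) ≤ c_d d M^{(d-1)/d} (sup_{[0,M]^d} f)^{1/d} |x-y|^{1/d}`,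
where `M = max_i max(x_i, y_i)`. -/
theorem longest_chain_holder_estimate_fixed
    {d : ℕ} (hd : 0 < d) (c : ℝ) (hc : IsBWConstant d c)
    (f : (Fin d → ℝ) → ℝ) (hf : MemB d f)
    {Ω : Type*} [MeasurableSpace Ω] (P : Measure Ω) [IsProbabilityMeasure P]
    (PP : ∀ n : ℕ, PoissonPP d P fun z => (n : ℝ) * f z)
    (x y : Fin d → ℝ) (hx : 0 ≤ x) (hy : 0 ≤ y) :
    P {ω | limsup (fun n : ℕ =>
        (n : ℝ) ^ (-(1 : ℝ) / d) *
          ((chainLength d ((PP n).pts ω ∩ Set.Icc 0 x) : ℝ) -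
            (chainLength d ((PP n).pts ω ∩ Set.Icc 0 y) : ℝ))) atTop
      ≤ c * d * (⨆ i, max (x i) (y i)) ^ (((d : ℝ) - 1) / d) *
        (sSup (f '' Set.Icc (0 : Fin d → ℝ) fun _ => ⨆ i, max (x i) (y i))) ^ ((1 : ℝ) / d) *
        euclNorm d (x - y) ^ ((1 : ℝ) / d)} = 1 := by
  have : Nonempty (Fin d) := ⟨⟨0, hd⟩⟩
  set M := ⨆ i, max (x i) (y i) with hMdef
  have hM : ∀ i, max (x i) (y i) ≤ M := fun i =>
    le_ciSup (f := fun i => max (x i) (y i)) (Set.finite_range _).bddAbove i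
  have hM0 : 0 ≤ M := ((hx ⟨0, hd⟩).trans (le_max_left _ _)).trans (hM ⟨0, hd⟩)
  set S := sSup (f '' Set.Icc (0 : Fin d → ℝ) fun _ => M) with hSdef
  have hS : ∀ z ∈ Set.Icc (0 : Fin d → ℝ) (fun _ => M), f z ≤ S := fun z hz =>
    le_csSup (hf.bddAbove_image isCompact_Icc) (Set.mem_image_of_mem f hz)
  have hS0 : 0 ≤ S := Real.sSup_nonneg (by rintro _ ⟨z, _, rfl⟩; exact hf.2.1 z)
  have hE0 : 0 ≤ euclNorm d (x - y) := Real.sqrt_nonneg _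
  have hc0 := hc.1
  have hd0 : (0 : ℝ) < d := by exact_mod_cast hd
  have hrhs : c * d * M ^ (((d : ℝ) - 1) / d) * S ^ ((1 : ℝ) / d) *
      euclNorm d (x - y) ^ ((1 : ℝ) / d) =
      d * ((c + 0) * (S * (M ^ (d - 1) * euclNorm d (x - y)) + 0) ^ (1 / d : ℝ)) := by
    have hexp : ((d : ℝ) - 1) / d = ((d - 1 : ℕ) : ℝ) * (1 / d) := by
      rw [Nat.cast_sub hd, Nat.cast_one]
      ring
    rw [add_zero, add_zero, Real.mul_rpow hS0 (by positivity), Real.mul_rpow (by positivity) hE0,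
      hexp, Real.rpow_natCast_mul hM0]
    ring
  have hη := tendsto_one_div_add_atTop_nhds_zero_nat (𝕜 := ℝ)
  have hlim : Tendsto (fun j : ℕ => d * ((c + 1 / ((j : ℝ) + 1)) *
      (S * (M ^ (d - 1) * euclNorm d (x - y)) + 1 / ((j : ℝ) + 1)) ^ (1 / d : ℝ))) atTop
      (𝓝 (d * ((c + 0) * (S * (M ^ (d - 1) * euclNorm d (x - y)) + 0) ^ (1 / d : ℝ)))) :=
    ((hη.const_add c).mul ((hη.const_add _).rpow_const (Or.inr (by positivity)))).const_mul _
  rw [hrhs]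
  refine (measure_congr (eventuallyEq_univ.2 ?_)).trans measure_univ
  filter_upwards [ae_all_iff.2 fun j : ℕ => ae_eventually_chainLength_sub_le hd hc
    (Nat.one_div_pos_of_nat (α := ℝ) (n := j)) hf PP hy hM hS hS0 hM0] with ω hω
  exact ge_of_tendsto' hlim fun j =>
    limsup_le_of_eventually_le_of_nonneg (by positivity) (hω j)

end
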